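/- arXiv:1103.2040 — 4 statements merged into one kernel-verified Lean document; each statement's English description precedes it below -/
import Mathlib

section
/- The subgroup 𝒢 of GL(8,ℂ) generated by the four linear transformations U₁ : (Y₀,Y₁,Y₃,Y₂,X₀,X₃,X₂,X₁), U₂ : (Y₀,Y₃,Y₂,Y₁,X₀,X₁,X₃,X₂), T : (Y₀,−iY₁,Y₂,−iY₃,X₁,X₀,X₃,X₂), and J : √2·(X₀,X₁,X₂,X₃,Y₀/2,Y₁/2,Y₂/2,Y₃/2) contains the scalar matrix i·I₈ and is a finite group of order 98304 = 2¹⁵·3; consequently the quotient 𝒢̄ = 𝒢/𝒵 by the order-4 group 𝒵 of scalar matrices generated by i·I₈ has order 24576 = 2¹³·3. -/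
noncomputable section

open Matrix Complex

/-- A matrix whose `i`-th row has the single entry `c i` in column `σ i`;
it sends the coordinate vector `v` to the vector `i ↦ c i * v (σ i)`. -/
def mkM (σ : Fin 8 → Fin 8) (c : Fin 8 → ℂ) : Matrix (Fin 8) (Fin 8) ℂ :=
  Matrix.of fun i j => if j = σ i then c i else 0

/-- `U₁ : (Y₀,Y₁,Y₃,Y₂,X₀,X₃,X₂,X₁)` -/
def U1M : Matrix (Fin 8) (Fin 8) ℂ := mkM ![0,1,3,2,4,7,6,5] (fun _ => 1)

/-- `U₂ : (Y₀,Y₃,Y₂,Y₁,X₀,X₁,X₃,X₂)` -/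
def U2M : Matrix (Fin 8) (Fin 8) ℂ := mkM ![0,3,2,1,4,5,7,6] (fun _ => 1)

/-- `T : (Y₀,−iY₁,Y₂,−iY₃,X₁,X₀,X₃,X₂)` -/
def TM : Matrix (Fin 8) (Fin 8) ℂ :=
  mkM ![0,1,2,3,5,4,7,6] ![1, -Complex.I, 1, -Complex.I, 1, 1, 1, 1]

/-- `J : √2·(X₀,X₁,X₂,X₃,Y₀/2,Y₁/2,Y₂/2,Y₃/2)` -/
def JM : Matrix (Fin 8) (Fin 8) ℂ :=
  mkM ![4,5,6,7,0,1,2,3]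
    ![(Real.sqrt 2 : ℂ), (Real.sqrt 2 : ℂ), (Real.sqrt 2 : ℂ), (Real.sqrt 2 : ℂ),
      (Real.sqrt 2 : ℂ)/2, (Real.sqrt 2 : ℂ)/2, (Real.sqrt 2 : ℂ)/2, (Real.sqrt 2 : ℂ)/2]

/-- The scalar matrix `i·I₈`. -/
def iI : Matrix (Fin 8) (Fin 8) ℂ := Complex.I • (1 : Matrix (Fin 8) (Fin 8) ℂ)

/-- The group `𝒢 ⊆ GL(8,ℂ)` generated by `U₁, U₂, T, J`. -/
def GG : Subgroup (GL (Fin 8) ℂ) :=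
  Subgroup.closure {g | (↑g : Matrix (Fin 8) (Fin 8) ℂ) = U1M ∨
    (↑g : Matrix (Fin 8) (Fin 8) ℂ) = U2M ∨ (↑g : Matrix (Fin 8) (Fin 8) ℂ) = TM ∨
    (↑g : Matrix (Fin 8) (Fin 8) ℂ) = JM}

/-- The group `𝒵` of scalar matrices generated by `i·I₈`. -/
def ZZ : Subgroup (GL (Fin 8) ℂ) :=
  Subgroup.closure {g | (↑g : Matrix (Fin 8) (Fin 8) ℂ) = iI}

/-- Monomial data: row `i` has its nonzero entry, the `c i`-th power of `I`, in column `σ i`. -/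
@[ext]
structure Mono where
  σ : Fin 8 → Fin 8
  c : Fin 8 → ZMod 4

namespace Mono

instance : DecidableEq Mono := fun _ _ => decidable_of_iff _ Mono.ext_iff.symm

instance : Monoid Mono where
  one := ⟨id, 0⟩
  mul m n := ⟨fun i => n.σ (m.σ i), fun i => m.c i + n.c (m.σ i)⟩
  one_mul m := Mono.ext rfl (funext fun _ => zero_add _)
  mul_one m := Mono.ext rfl (funext fun _ => add_zero _)
  mul_assoc _ _ _ := Mono.ext rfl (funext fun _ => add_assoc _ _ _)

/-- The diagonal monomial data with exponents `c`. -/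
def diag (c : Fin 8 → ZMod 4) : Mono := ⟨id, c⟩

lemma diag_add (c d : Fin 8 → ZMod 4) : diag (c + d) = diag c * diag d := rfl

def u1 : Mono := ⟨![0, 1, 3, 2, 4, 7, 6, 5], 0⟩

def u2 : Mono := ⟨![0, 3, 2, 1, 4, 5, 7, 6], 0⟩

def t : Mono := ⟨![0, 1, 2, 3, 5, 4, 7, 6], ![0, 3, 0, 3, 0, 0, 0, 0]⟩

def j : Mono := ⟨![4, 5, 6, 7, 0, 1, 2, 3], 0⟩

/-- The scaling of the coordinates that turns `J` into a permutation matrix. -/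
def weight : Fin 8 → ℂ :=
  ![1, 1, 1, 1, (Real.sqrt 2 : ℂ), (Real.sqrt 2 : ℂ), (Real.sqrt 2 : ℂ), (Real.sqrt 2 : ℂ)]

lemma sqrt_two_ne_zero : (Real.sqrt 2 : ℂ) ≠ 0 := by simp

lemma weight_ne_zero (i : Fin 8) : weight i ≠ 0 := by
  fin_cases i <;> simp [weight]

/-- The nonzero entry in the `i`-th row of `toMatrix m`. -/
def entry (m : Mono) (i : Fin 8) : ℂ := I ^ (m.c i).val * (weight (m.σ i) / weight i)

lemma entry_ne_zero (m : Mono) (i : Fin 8) : m.entry i ≠ 0 :=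
  mul_ne_zero (pow_ne_zero _ I_ne_zero) (div_ne_zero (weight_ne_zero _) (weight_ne_zero _))

lemma I_pow_val_add (a b : ZMod 4) : I ^ (a + b).val = I ^ a.val * I ^ b.val := by
  rw [ZMod.val_add, ← I_pow_eq_pow_mod, pow_add]

lemma I_pow_val_injective : Function.Injective fun a : ZMod 4 => I ^ a.val := fun a b h =>
  ZMod.val_injective 4 (isPrimitiveRoot_I.pow_inj a.val_lt b.val_lt h)

/-- The matrix of a monomial datum, in the scaled coordinates. -/
def toMatrix : Mono →* Matrix (Fin 8) (Fin 8) ℂ where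
  toFun m := mkM m.σ m.entry
  map_one' := by
    ext i k
    have h : (1 : Mono).entry i = 1 := by
      change I ^ (0 : ZMod 4).val * (weight i / weight i) = 1
      rw [div_self (weight_ne_zero i), ZMod.val_zero, pow_zero, one_mul]
    rw [Matrix.one_apply]
    change (if k = i then (1 : Mono).entry i else 0) = _
    simp only [h, eq_comm]
  map_mul' m n := by
    ext i k
    have h : (m * n).entry i = m.entry i * n.entry (m.σ i) := by
      change I ^ (m.c i + n.c (m.σ i)).val * (weight (n.σ (m.σ i)) / weight i) = _
      rw [I_pow_val_add, entry, entry]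
      have h1 := weight_ne_zero i
      have h2 := weight_ne_zero (m.σ i)
      field_simp
    rw [Matrix.mul_apply]
    change (if k = n.σ (m.σ i) then (m * n).entry i else 0) =
      ∑ l, (if l = m.σ i then m.entry i else 0) * (if k = n.σ l then n.entry l else 0)
    rw [Finset.sum_eq_single (m.σ i) (fun l _ hl => by rw [if_neg hl, zero_mul]) (by simp),
      if_pos rfl, h, mul_ite, mul_zero]

lemma toMatrix_apply (m : Mono) (i k : Fin 8) :
    toMatrix m i k = if k = m.σ i then m.entry i else 0 := rfl

lemma toMatrix_injective : Function.Injective toMatrix := by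
  intro m n h
  have hσ : m.σ = n.σ := by
    funext i
    by_contra hne
    have := congrFun (congrFun h i) (m.σ i)
    rw [toMatrix_apply, toMatrix_apply, if_pos rfl, if_neg hne] at this
    exact entry_ne_zero m i this
  refine Mono.ext hσ (funext fun i => I_pow_val_injective ?_)
  have := congrFun (congrFun h i) (m.σ i)
  rw [toMatrix_apply, toMatrix_apply, if_pos rfl, if_pos (congrFun hσ i), entry, entry,
    ← hσ] at this
  exact mul_right_cancel₀ (div_ne_zero (weight_ne_zero _) (weight_ne_zero _)) this

lemma sqrt_two_div_two : (1 : ℂ) / (Real.sqrt 2 : ℂ) = (Real.sqrt 2 : ℂ) / 2 := by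
  have h : (Real.sqrt 2 : ℂ) * (Real.sqrt 2 : ℂ) = 2 := by
    rw [← Complex.ofReal_mul, Real.mul_self_sqrt (by norm_num)]; norm_num
  rw [div_eq_div_iff sqrt_two_ne_zero two_ne_zero, h, one_mul]

lemma toMatrix_u1 : toMatrix u1 = U1M := by
  refine congrArg (mkM _) (funext fun i => ?_)
  fin_cases i <;> simp [entry, u1, weight]

lemma toMatrix_u2 : toMatrix u2 = U2M := by
  refine congrArg (mkM _) (funext fun i => ?_)
  fin_cases i <;> simp [entry, u2, weight]

lemma toMatrix_t : toMatrix t = TM := by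
  have h : (3 : ZMod 4).val = 3 := rfl
  refine congrArg (mkM _) (funext fun i => ?_)
  fin_cases i <;> simp [entry, t, weight, h]

lemma toMatrix_j : toMatrix j = JM := by
  have h := sqrt_two_div_two
  rw [one_div] at h
  refine congrArg (mkM _) (funext fun i => ?_)
  fin_cases i <;> simp [entry, j, weight, h]

lemma toMatrix_scalarI : toMatrix (diag 1) = iI := by
  ext i k
  have h : (diag 1).entry i = I := by
    change I ^ (1 : ZMod 4).val * (weight i / weight i) = I
    rw [div_self (weight_ne_zero i), mul_one]
    exact pow_one I
  rw [toMatrix_apply, h, iI, Matrix.smul_apply, Matrix.one_apply]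
  change (if k = i then I else 0) = _
  simp [eq_comm]

/-- The generators of `𝒢`. -/
def generators : Set Mono := {u1, u2, t, j}

section Submonoid

variable {S : Submonoid Mono}

/-- `xTranslation k` translates the `X`-indices by the bitwise sum with `k`. -/
def xTranslation : Fin 4 → Mono := ![1, t,
  ⟨![0, 1, 2, 3, 6, 7, 4, 5], ![0, 0, 3, 3, 0, 0, 0, 0]⟩,
  ⟨![0, 1, 2, 3, 7, 6, 5, 4], ![0, 3, 3, 0, 0, 0, 0, 0]⟩]

/-- `yTranslation k` translates the `Y`-indices by the bitwise sum with `k`. -/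
def yTranslation : Fin 4 → Mono := ![1,
  ⟨![1, 0, 3, 2, 4, 5, 6, 7], ![0, 0, 0, 0, 0, 3, 0, 3]⟩,
  ⟨![2, 3, 0, 1, 4, 5, 6, 7], ![0, 0, 0, 0, 0, 0, 3, 3]⟩,
  ⟨![3, 2, 1, 0, 4, 5, 6, 7], ![0, 0, 0, 0, 0, 3, 3, 0]⟩]

/-- The elements of the copy of `S₃` generated by `u1` and `u2`. -/
def symmetry : Fin 6 → Mono := ![1, u1, u2,
  ⟨![0, 3, 1, 2, 4, 6, 7, 5], 0⟩,
  ⟨![0, 2, 3, 1, 4, 7, 5, 6], 0⟩,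
  ⟨![0, 2, 1, 3, 4, 6, 5, 7], 0⟩]

/-- Parameters of the elements of `𝒢` modulo sign changes of the coordinates. -/
abbrev Param := Fin 2 × Fin 6 × Fin 4 × Fin 4 × Fin 2

/-- A representative of the class with the given parameters. -/
def representative (x : Param) : Mono :=
  diag 1 ^ x.1.val * symmetry x.2.1 * xTranslation x.2.2.1 * yTranslation x.2.2.2.1 *
    j ^ x.2.2.2.2.val

/-- The sign change of the coordinates `i` with `b i = true`. -/
def signChange (b : Fin 8 → Bool) : Fin 8 → ZMod 4 := fun i => if b i then 2 else 0

lemma symmetry_mem (hS : generators ⊆ S) (k : Fin 6) : symmetry k ∈ S := by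
  have h1 : u1 ∈ S := hS (by simp [generators])
  have h2 : u2 ∈ S := hS (by simp [generators])
  fin_cases k
  · exact one_mem S
  · exact h1
  · exact h2
  · have h : symmetry 3 = u1 * u2 := by decide +kernel
    exact h ▸ mul_mem h1 h2
  · have h : symmetry 4 = u2 * u1 := by decide +kernel
    exact h ▸ mul_mem h2 h1
  · have h : symmetry 5 = u1 * u2 * u1 := by decide +kernel
    exact h ▸ mul_mem (mul_mem h1 h2) h1

lemma xTranslation_mem (hS : generators ⊆ S) (k : Fin 4) : xTranslation k ∈ S := by
  have h1 : u1 ∈ S := hS (by simp [generators])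
  have h2 : u2 ∈ S := hS (by simp [generators])
  have ht : t ∈ S := hS (by simp [generators])
  fin_cases k
  · exact one_mem S
  · exact ht
  · have h : xTranslation 2 = u2 * u1 * t * u1 * u2 := by decide +kernel
    exact h ▸ mul_mem (mul_mem (mul_mem (mul_mem h2 h1) ht) h1) h2
  · have h : xTranslation 3 = u1 * t * u1 := by decide +kernel
    exact h ▸ mul_mem (mul_mem h1 ht) h1

lemma j_mem (hS : generators ⊆ S) : j ∈ S := hS (by simp [generators])

lemma yTranslation_mem (hS : generators ⊆ S) (k : Fin 4) : yTranslation k ∈ S := by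
  have h : ∀ k, yTranslation k = j * xTranslation k * j := by decide +kernel
  exact h k ▸ mul_mem (mul_mem (j_mem hS) (xTranslation_mem hS k)) (j_mem hS)

lemma scalarI_mem (hS : generators ⊆ S) : diag 1 ∈ S := by
  have ht : t ∈ S := hS (by simp [generators])
  have h : diag 1 = (t ^ 3 * j) ^ 4 := by decide +kernel
  rw [h]
  exact pow_mem (mul_mem (pow_mem ht 3) (j_mem hS)) 4

lemma diag_single_mem (hS : generators ⊆ S) (i : Fin 8) : diag (Pi.single i 2) ∈ S := by
  have h1 : u1 ∈ S := hS (by simp [generators])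
  have h2 : u2 ∈ S := hS (by simp [generators])
  have ht : t ∈ S := hS (by simp [generators])
  have hj := j_mem hS
  have hy := yTranslation_mem hS 1
  have e1 : diag (Pi.single 1 2) ∈ S := by
    have h : diag (Pi.single 1 2) = u1 * u2 * u1 * t ^ 3 * u1 * u2 * t * u1 * t := by
      decide +kernel
    rw [h]
    exact mul_mem (mul_mem (mul_mem (mul_mem (mul_mem (mul_mem (mul_mem (mul_mem
      h1 h2) h1) (pow_mem ht 3)) h1) h2) ht) h1) ht
  have e3 : diag (Pi.single 3 2) ∈ S := by
    have h : diag (Pi.single 3 2) = u2 * diag (Pi.single 1 2) * u2 := by decide +kernel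
    exact h ▸ mul_mem (mul_mem h2 e1) h2
  have e2 : diag (Pi.single 2 2) ∈ S := by
    have h : diag (Pi.single 2 2) = u1 * diag (Pi.single 3 2) * u1 := by decide +kernel
    exact h ▸ mul_mem (mul_mem h1 e3) h1
  have e0 : diag (Pi.single 0 2) ∈ S := by
    have h : diag (Pi.single 0 2) =
        yTranslation 1 * diag (Pi.single 1 2) * yTranslation 1 ^ 3 := by decide +kernel
    exact h ▸ mul_mem (mul_mem hy e1) (pow_mem hy 3)
  have hX : ∀ k : Fin 8, diag (Pi.single k 2) ∈ S → diag (Pi.single (j.σ k) 2) ∈ S := by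
    intro k hk
    have h : ∀ k : Fin 8, diag (Pi.single (j.σ k) 2) = j * diag (Pi.single k 2) * j := by
      decide +kernel
    exact h k ▸ mul_mem (mul_mem hj hk) hj
  fin_cases i
  exacts [e0, e1, e2, e3, hX 0 e0, hX 1 e1, hX 2 e2, hX 3 e3]

lemma diag_signChange_mem (hS : generators ⊆ S) (b : Fin 8 → Bool) :
    diag (signChange b) ∈ S := by
  let D : AddSubmonoid (Fin 8 → ZMod 4) :=
    { carrier := {c | diag c ∈ S}
      zero_mem' := one_mem S
      add_mem' := fun {c d} hc hd => by
        change diag (c + d) ∈ S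
        exact diag_add c d ▸ mul_mem hc hd }
  change signChange b ∈ D
  rw [← Finset.univ_sum_single (signChange b)]
  refine sum_mem fun i _ => ?_
  by_cases h : b i
  · have hi : signChange b i = 2 := if_pos h
    exact hi ▸ diag_single_mem hS i
  · simp [signChange, h]

lemma representative_mem (hS : generators ⊆ S) (x : Param) : representative x ∈ S :=
  mul_mem (mul_mem (mul_mem (mul_mem (pow_mem (scalarI_mem hS) _) (symmetry_mem hS _))
    (xTranslation_mem hS _)) (yTranslation_mem hS _)) (pow_mem (j_mem hS) _)

end Submonoid

/-- The index `k` such that `symmetry k` maps the `Y`-indices `1` and `2` to `p` and `q`. -/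
def symmetryIndex (p q : ℕ) : Fin 6 :=
  match p, q with
  | 1, 3 => 1
  | 3, 2 => 2
  | 3, 1 => 3
  | 2, 3 => 4
  | 2, 1 => 5
  | _, _ => 0

/-- The parameters of the class of an element of `𝒢`. -/
def param (m : Mono) : Param :=
  let e : ℕ := (m.σ 0).val / 4
  let p : Fin 8 → ℕ := fun i => (m.σ i).val % 4
  (Fin.ofNat 2 (m.c 0).val, symmetryIndex (p 1 ^^^ p 0) (p 2 ^^^ p 0), Fin.ofNat 4 (p 4),
    Fin.ofNat 4 (p 0), Fin.ofNat 2 e)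

/-- Two monomial data agree up to sign changes of the coordinates. -/
def SignEquiv (m n : Mono) : Prop := m.σ = n.σ ∧ ∀ i, (m.c i).val % 2 = (n.c i).val % 2

instance (m n : Mono) : Decidable (SignEquiv m n) := inferInstanceAs (Decidable (_ ∧ _))

lemma param_representative : ∀ x, param (representative x) = x := by
  decide +kernel

lemma signEquiv_representative_mul : ∀ x : Param, ∀ g ∈ [u1, u2, t, j],
    SignEquiv (representative x * g) (representative (param (representative x * g))) := by
  decide +kernel

lemma exists_signChange_add {a b : Fin 8 → ZMod 4} (h : ∀ i, (a i).val % 2 = (b i).val % 2) :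
    ∃ s, a = signChange s + b := by
  have key : ∀ p q : ZMod 4, p.val % 2 = q.val % 2 → ∃ s : Bool, p = (if s then 2 else 0) + q := by
    decide
  choose s hs using fun i => key (a i) (b i) (h i)
  exact ⟨s, funext hs⟩

/-- The elements of `𝒢`, enumerated by sign changes and parameters. -/
def element (p : (Fin 8 → Bool) × Param) : Mono := diag (signChange p.1) * representative p.2

lemma element_injective : Function.Injective element := by
  rintro ⟨b, x⟩ ⟨b', x'⟩ h
  have h2 : ∀ (b : Fin 8 → Bool) (m : Mono),
      param (diag (signChange b) * m) = param m := by
    intro b m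
    have key : ∀ (s : Bool) (a : ZMod 4),
        Fin.ofNat 2 ((if s then 2 else 0) + a).val = Fin.ofNat 2 a.val := by decide
    exact congrArg (fun z => (z, _)) (key (b 0) (m.c 0))
  have hx : x = x' := by
    have := congrArg param h
    rwa [element, element, h2, h2, param_representative, param_representative] at this
  subst hx
  have key : ∀ s s' : Bool, ((if s then 2 else 0 : ZMod 4) = if s' then 2 else 0) → s = s' := by
    decide
  refine Prod.ext (funext fun i => key _ _ ?_) rfl
  exact add_right_cancel (congrFun (congrArg Mono.c h) i)

lemma exists_element_eq_mul (p : (Fin 8 → Bool) × Param) {g : Mono} (hg : g ∈ generators) :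
    ∃ q, element q = element p * g := by
  obtain ⟨b, x⟩ := p
  obtain ⟨hσ, hc⟩ := signEquiv_representative_mul x g (by simpa [generators] using hg)
  obtain ⟨s, hs⟩ := exists_signChange_add hc
  have hs' : representative x * g =
      diag (signChange s) * representative (param (representative x * g)) := Mono.ext hσ hs
  obtain ⟨r, hr⟩ : ∃ r, signChange b + signChange s = signChange r + 0 :=
    exists_signChange_add fun i => by
      have key : ∀ u v : Bool,
          ((if u then 2 else 0 : ZMod 4) + (if v then 2 else 0)).val % 2 = (0 : ZMod 4).val % 2 := by
        decide
      exact key (b i) (s i)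
  rw [add_zero] at hr
  refine ⟨(r, param (representative x * g)), ?_⟩
  calc diag (signChange r) * representative (param (representative x * g))
      = diag (signChange b) * (representative x * g) := by
        rw [hs', ← mul_assoc, ← diag_add, hr, ← hs']
    _ = element (b, x) * g := (mul_assoc _ _ _).symm

lemma pow_four_of_mem_generators {g : Mono} (hg : g ∈ generators) : g ^ 4 = 1 := by
  have key : ∀ g ∈ [u1, u2, t, j], g ^ 4 = 1 := by decide +kernel
  exact key g (by simpa [generators] using hg)

end Mono

open Mono

/-- The monomial data whose matrices lie in `𝒢`. -/
def monomialsOfGG : Submonoid Mono :=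
  (GG.toSubmonoid.map (Units.coeHom (Matrix (Fin 8) (Fin 8) ℂ))).comap toMatrix

lemma exists_mem_GG_coe_eq {m : Mono} (hm : m ∈ monomialsOfGG) :
    ∃ g : GL (Fin 8) ℂ, (↑g : Matrix (Fin 8) (Fin 8) ℂ) = toMatrix m ∧ g ∈ GG := by
  obtain ⟨g, hg, h⟩ := hm
  exact ⟨g, h, hg⟩

lemma mem_toMatrix_image_generators {M : Matrix (Fin 8) (Fin 8) ℂ} :
    (M = U1M ∨ M = U2M ∨ M = TM ∨ M = JM) ↔ ∃ m ∈ generators, M = toMatrix m := by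
  simp [generators, toMatrix_u1, toMatrix_u2, toMatrix_t, toMatrix_j]

lemma mem_monomialsOfGG_of_mem_generators : generators ⊆ monomialsOfGG := by
  intro m hm
  have h : toMatrix m * toMatrix (m ^ 3) = 1 := by
    rw [← map_mul, ← pow_succ', pow_four_of_mem_generators hm, map_one]
  have h' : toMatrix (m ^ 3) * toMatrix m = 1 := by
    rw [← map_mul, ← pow_succ, pow_four_of_mem_generators hm, map_one]
  exact ⟨⟨toMatrix m, toMatrix (m ^ 3), h, h'⟩,
    Subgroup.subset_closure (mem_toMatrix_image_generators.mpr ⟨m, hm, rfl⟩), rfl⟩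

lemma exists_element_of_mem_GG {g : GL (Fin 8) ℂ} (hg : g ∈ GG) :
    ∃ p, (↑g : Matrix (Fin 8) (Fin 8) ℂ) = toMatrix (element p) := by
  induction hg using Subgroup.closure_induction_right with
  | one =>
    refine ⟨(fun _ => false, (0, 0, 0, 0, 0)), ?_⟩
    have h : element (fun _ => false, (0, 0, 0, 0, 0)) = 1 := by decide +kernel
    rw [h, map_one, Units.val_one]
  | mul_right x _ y hy ih =>
    obtain ⟨p, hp⟩ := ih
    obtain ⟨m, hm, hym⟩ := mem_toMatrix_image_generators.mp hy
    obtain ⟨q, hq⟩ := exists_element_eq_mul p hm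
    exact ⟨q, by rw [Units.val_mul, hp, hym, hq, map_mul]⟩
  | mul_inv_cancel x _ y hy ih =>
    obtain ⟨p, hp⟩ := ih
    obtain ⟨m, hm, hym⟩ := mem_toMatrix_image_generators.mp hy
    have hy4 : y ^ 4 = 1 := by
      ext1
      rw [Units.val_pow_eq_pow_val, hym, ← map_pow, pow_four_of_mem_generators hm, map_one,
        Units.val_one]
    have hinv : y⁻¹ = y * y * y := by
      rw [inv_eq_iff_mul_eq_one, ← hy4]
      simp only [pow_succ, pow_zero, one_mul, mul_assoc]
    obtain ⟨q, hq⟩ := exists_element_eq_mul p hm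
    obtain ⟨q', hq'⟩ := exists_element_eq_mul q hm
    obtain ⟨q'', hq''⟩ := exists_element_eq_mul q' hm
    refine ⟨q'', ?_⟩
    rw [hinv, hq'', hq', hq]
    simp only [Units.val_mul, hp, hym, map_mul, mul_assoc]

lemma card_GG : Nat.card GG = 98304 := by
  have hmem (p) : element p ∈ monomialsOfGG :=
    mul_mem (diag_signChange_mem mem_monomialsOfGG_of_mem_generators _)
      (representative_mem mem_monomialsOfGG_of_mem_generators _)
  choose f hf hfG using fun p => exists_mem_GG_coe_eq (hmem p)
  have hbij : Function.Bijective fun p => (⟨f p, hfG p⟩ : GG) := by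
    refine ⟨fun p q h => element_injective (toMatrix_injective ?_), fun ⟨g, hg⟩ => ?_⟩
    · rw [← hf p, ← hf q, Subtype.mk.inj h]
    · obtain ⟨p, hp⟩ := exists_element_of_mem_GG hg
      exact ⟨p, Subtype.ext (Units.ext ((hf p).trans hp.symm))⟩
  rw [← Nat.card_eq_of_bijective _ hbij]
  simp

lemma ZZ_eq_zpowers {g : GL (Fin 8) ℂ} (hg : (↑g : Matrix (Fin 8) (Fin 8) ℂ) = iI) :
    ZZ = Subgroup.zpowers g := by
  rw [Subgroup.zpowers_eq_closure, ZZ]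
  congr 1
  ext h
  rw [Set.mem_ofPred_eq, Set.mem_singleton_iff, ← hg, Units.val_inj]

lemma card_ZZ {g : GL (Fin 8) ℂ} (hg : (↑g : Matrix (Fin 8) (Fin 8) ℂ) = iI) :
    Nat.card ZZ = 4 := by
  rw [ZZ_eq_zpowers hg, Nat.card_zpowers, ← orderOf_units, hg, ← toMatrix_scalarI,
    orderOf_injective _ toMatrix_injective]
  exact orderOf_eq_prime_pow (p := 2) (n := 1) (by decide +kernel) (by decide +kernel)

/-- `𝒢` contains `i·I₈`, is finite of order `98304 = 2¹⁵·3`, `𝒵` has order `4`, and the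
quotient `𝒢̄ = 𝒢/𝒵` has order `24576 = 2¹³·3`. -/
theorem statement0 :
    (∃ g : GL (Fin 8) ℂ, (↑g : Matrix (Fin 8) (Fin 8) ℂ) = iI ∧ g ∈ GG) ∧
    Nat.card ZZ = 4 ∧
    Nat.card GG = 98304 ∧
    Nat.card (GG ⧸ ZZ.subgroupOf GG) = 24576 := by
  obtain ⟨g, hg, hgG⟩ := exists_mem_GG_coe_eq (scalarI_mem mem_monomialsOfGG_of_mem_generators)
  rw [toMatrix_scalarI] at hg
  have hZ : Nat.card ZZ = 4 := card_ZZ hg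
  have hZG : ZZ ≤ GG := by
    rw [ZZ_eq_zpowers hg]
    exact Subgroup.zpowers_le.mpr hgG
  refine ⟨⟨g, hg, hgG⟩, hZ, card_GG, ?_⟩
  have h := Subgroup.card_eq_card_quotient_mul_card_subgroup (ZZ.subgroupOf GG)
  rw [card_GG, Nat.card_congr (Subgroup.subgroupOfEquivOfLe hZG).toEquiv, hZ] at h
  omega
end
end

section
/- The subgroup ℋ of GL(8,ℂ) generated by U₁U₂, U₁T, U₂T and J is a subgroup of index 2 in 𝒢, contains the scalar matrix i·I₈, and has order 49152 = 2¹⁴·3; consequently ℋ̄ = ℋ/𝒵 has order 12288 = 2¹²·3. -/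
noncomputable section

open Matrix Complex

/-- The group `ℋ ⊆ GL(8,ℂ)` generated by `U₁U₂, U₁T, U₂T, J`. -/
def HH : Subgroup (GL (Fin 8) ℂ) :=
  Subgroup.closure {g | (↑g : Matrix (Fin 8) (Fin 8) ℂ) = U1M * U2M ∨
    (↑g : Matrix (Fin 8) (Fin 8) ℂ) = U1M * TM ∨
    (↑g : Matrix (Fin 8) (Fin 8) ℂ) = U2M * TM ∨
    (↑g : Matrix (Fin 8) (Fin 8) ℂ) = JM}

namespace Monomial

/-- Permutations of the coordinates act on vectors of phases in `ℤ/n`. -/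
def permAut (n : ℕ) : Equiv.Perm (Fin 8) →* MulAut (Fin 8 → Multiplicative (ZMod n)) where
  toFun σ := MulEquiv.arrowCongr σ (MulEquiv.refl _)
  map_one' := rfl
  map_mul' _ _ := rfl

/-- Monomial `8 × 8` matrices whose nonzero entries are phases in `ℤ/n`: the pair `(c, σ)` has
the entry `c (σ k)` in row `σ k` and column `k`. -/
abbrev Mono (n : ℕ) :=
  SemidirectProduct (Fin 8 → Multiplicative (ZMod n)) (Equiv.Perm (Fin 8)) (permAut n)

/-- Unlike the derived instance, this one is evaluated by the kernel. -/
instance (n : ℕ) : DecidableEq (Mono n) := fun x y =>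
  decidable_of_iff (x.left = y.left ∧ x.right = y.right) SemidirectProduct.ext_iff.symm

theorem card_mono (n : ℕ) : Nat.card (Mono n) = n ^ 8 * 40320 := by
  rw [SemidirectProduct.card, Nat.card_fun, Nat.card_perm]
  simp [Nat.card_congr (Multiplicative.toAdd (α := ZMod n)), Nat.card_zmod, Nat.factorial]

section Generators

variable (n : ℕ)

def u₁ : Mono n := ⟨1, Equiv.swap 2 3 * Equiv.swap 5 7⟩

def u₂ : Mono n := ⟨1, Equiv.swap 1 3 * Equiv.swap 6 7⟩

def t : Mono n :=
  ⟨fun i => Multiplicative.ofAdd (if i = 1 ∨ i = 3 then -1 else 0),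
    Equiv.swap 4 5 * Equiv.swap 6 7⟩

def j : Mono n :=
  ⟨1, Equiv.swap 0 4 * Equiv.swap 1 5 * Equiv.swap 2 6 * Equiv.swap 3 7⟩

/-- The group generated by `U₁, U₂, T, J`, with phases in `ℤ/n`. -/
def G : Subgroup (Mono n) := Subgroup.closure {u₁ n, u₂ n, t n, j n}

/-- The group generated by `U₁U₂, U₁T, U₂T, J`, with phases in `ℤ/n`. -/
def H : Subgroup (Mono n) := Subgroup.closure {u₁ n * u₂ n, u₁ n * t n, u₂ n * t n, j n}

variable {n}

theorem u₁_mem_G : u₁ n ∈ G n := Subgroup.subset_closure (by simp)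

theorem u₂_mem_G : u₂ n ∈ G n := Subgroup.subset_closure (by simp)

theorem t_mem_G : t n ∈ G n := Subgroup.subset_closure (by simp)

theorem j_mem_G : j n ∈ G n := Subgroup.subset_closure (by simp)

theorem u₁_mul_u₂_mem_H : u₁ n * u₂ n ∈ H n := Subgroup.subset_closure (by simp)

theorem u₁_mul_t_mem_H : u₁ n * t n ∈ H n := Subgroup.subset_closure (by simp)

theorem u₂_mul_t_mem_H : u₂ n * t n ∈ H n := Subgroup.subset_closure (by simp)

theorem j_mem_H : j n ∈ H n := Subgroup.subset_closure (by simp)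

theorem H_le_G : H n ≤ G n := by
  rw [H, Subgroup.closure_le]
  rintro x (rfl | rfl | rfl | rfl)
  · exact mul_mem u₁_mem_G u₂_mem_G
  · exact mul_mem u₁_mem_G t_mem_G
  · exact mul_mem u₂_mem_G t_mem_G
  · exact j_mem_G

end Generators

section ModTwo

/-- Exponents of the normal form `q` for the elements of `G 2`. -/
abbrev Param := (Fin 2 × (Fin 2 × Fin 2) × Fin 2 × Fin 2) × (Fin 2 × Fin 3) × Fin 2

/-- The scalar matrix with phase `1 : ℤ/2`. -/
def z : Mono 2 := ⟨fun _ => Multiplicative.ofAdd 1, 1⟩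

/-- Products of conjugates of `t` under `⟨u₁, u₂⟩`. -/
def translation (b : Fin 2 × Fin 2) : Mono 2 := t 2 ^ b.1.val * (u₁ 2 * t 2 * u₁ 2) ^ b.2.val

/-- The elements of `⟨u₁, u₂⟩ ≅ S₃`. -/
def linear (a : Fin 2 × Fin 3) : Mono 2 := u₁ 2 ^ a.1.val * (u₁ 2 * u₂ 2) ^ a.2.val

/-- A normal form for the elements of the extraspecial normal subgroup of order `32`. -/
def extraspecial (p : Fin 2 × (Fin 2 × Fin 2) × Fin 2 × Fin 2) : Mono 2 :=
  z ^ p.1.val * translation p.2.1 * (j 2 * translation p.2.2 * j 2)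

/-- The elements of a complement of the extraspecial subgroup, which have trivial phases. -/
def perm (p : (Fin 2 × Fin 3) × Fin 2) : Mono 2 := linear p.1 * j 2 ^ p.2.val

/-- A normal form for the elements of `G 2`. -/
def q (p : Param) : Mono 2 := extraspecial p.1 * perm p.2

/-- The exponents of the element of the extraspecial subgroup with the given phases. -/
def decodeExtraspecial (v : Fin 8 → Multiplicative (ZMod 2)) :
    Fin 2 × (Fin 2 × Fin 2) × Fin 2 × Fin 2 :=
  let c : Fin 8 → Fin 2 := fun i => Multiplicative.toAdd (v i)
  (c 0, (c 1 - c 2, c 2 - c 0), c 5 - c 6, c 6 - c 4)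

/-- The exponents of the element of the complement with the given permutation. -/
def decodePerm (σ : Equiv.Perm (Fin 8)) : (Fin 2 × Fin 3) × Fin 2 :=
  let swapped : Bool := 4 ≤ σ 0
  let a : Fin 4 → ℕ := fun y => (σ (if swapped then y.natAdd 4 else y.castAdd 4)).val % 4
  let e : Fin 2 := if a 2 % 3 = (a 1 + 1) % 3 then 0 else 1
  ((e, if e = 0 then Fin.ofNat 3 (a 1 + 2) else Fin.ofNat 3 (4 - a 1)), if swapped then 1 else 0)

/-- The exponents of the normal form of an element of `G 2`. -/
def decode (x : Mono 2) : Param :=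
  (decodeExtraspecial x.left,
    decodePerm ((extraspecial (decodeExtraspecial x.left)).right⁻¹ * x.right))

/-- Twice the parity of the `S₃`-component of an element of `G 2`. -/
def sgn (x : Mono 2) : ZMod 4 := if (decode x).2.1.1 = 0 then 0 else 2

theorem q_mem (p : Param) : q p ∈ G 2 := by
  have hz : z ∈ G 2 := by
    rw [show z = (t 2 * j 2) ^ 4 by decide +kernel]
    exact pow_mem (mul_mem t_mem_G j_mem_G) 4
  have ht (b) : translation b ∈ G 2 :=
    mul_mem (pow_mem t_mem_G _) (pow_mem (mul_mem (mul_mem u₁_mem_G t_mem_G) u₁_mem_G) _)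
  have hl (a) : linear a ∈ G 2 :=
    mul_mem (pow_mem u₁_mem_G _) (pow_mem (mul_mem u₁_mem_G u₂_mem_G) _)
  rw [q, extraspecial, perm]
  exact mul_mem (mul_mem (mul_mem (pow_mem hz _) (ht _)) (mul_mem (mul_mem j_mem_G (ht _)) j_mem_G))
    (mul_mem (hl _) (pow_mem j_mem_G _))

theorem perm_left : ∀ p, (perm p).left = 1 := by decide +kernel

theorem decodeExtraspecial_extraspecial : ∀ p, decodeExtraspecial (extraspecial p).left = p := by
  decide +kernel

theorem decodePerm_perm : ∀ p, decodePerm (perm p).right = p := by decide +kernel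

theorem decode_q (p : Param) : decode (q p) = p := by
  rw [decode, q, SemidirectProduct.mul_left, SemidirectProduct.mul_right, perm_left, map_one,
    mul_one, decodeExtraspecial_extraspecial, inv_mul_cancel_left, decodePerm_perm]

theorem q_zero : q 0 = 1 := by decide +kernel

theorem semiconj_u₁_translation : ∀ b, SemiconjBy (u₁ 2) (translation b) (translation b.swap) := by
  unfold SemiconjBy
  decide +kernel

theorem semiconj_u₂_translation : ∀ b,
    SemiconjBy (u₂ 2) (translation b) (translation (b.1 + b.2, b.2)) := by
  unfold SemiconjBy
  decide +kernel

theorem semiconj_u₁_conj_translation : ∀ b, SemiconjBy (u₁ 2) (j 2 * translation b * j 2)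
    (j 2 * translation (b.1 + b.2, b.2) * j 2) := by
  unfold SemiconjBy
  decide +kernel

theorem semiconj_u₂_conj_translation : ∀ b, SemiconjBy (u₂ 2) (j 2 * translation b * j 2)
    (j 2 * translation b.swap * j 2) := by
  unfold SemiconjBy
  decide +kernel

theorem commute_u₁_z : Commute (u₁ 2) z := by
  unfold Commute SemiconjBy
  decide +kernel

theorem commute_u₂_z : Commute (u₂ 2) z := by
  unfold Commute SemiconjBy
  decide +kernel

theorem commute_t_z : Commute (t 2) z := by
  unfold Commute SemiconjBy
  decide +kernel

theorem u₁_mul_linear : ∀ a, u₁ 2 * linear a = linear (a.1 + 1, a.2) := by decide +kernel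

theorem u₂_mul_linear : ∀ a, u₂ 2 * linear a =
    linear (a.1 + 1, if a.1 = 0 then a.2 + 1 else a.2 - 1) := by decide +kernel

theorem t_mul_translation : ∀ b, t 2 * translation b = translation (b.1 + 1, b.2) := by
  decide +kernel

theorem semiconj_j_linear : ∀ a,
    SemiconjBy (j 2) (linear a) (linear (a.1, if a.1 = 0 then -a.2 else 1 - a.2)) := by
  unfold SemiconjBy
  decide +kernel

theorem j_mul_j_pow : ∀ s : Fin 2, j 2 * j 2 ^ s.val = j 2 ^ (s + 1).val := by decide +kernel

theorem j_mul_translation_mul : ∀ (k : Fin 2) (b b' : Fin 2 × Fin 2),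
    j 2 * (z ^ k.val * translation b' * (j 2 * translation b * j 2)) =
      z ^ (k + b.1 * (b'.1 + b'.2) + b.2 * b'.1).val * translation b *
        (j 2 * translation b' * j 2) * j 2 := by decide +kernel

theorem u₁_mul_q (p : Param) : u₁ 2 * q p = q ((p.1.1, p.1.2.1.swap, p.1.2.2.1 + p.1.2.2.2,
    p.1.2.2.2), (p.2.1.1 + 1, p.2.1.2), p.2.2) := by
  have h := (SemiconjBy.mul_right (commute_u₁_z.pow_right p.1.1.val)
    (semiconj_u₁_translation p.1.2.1)).mul_right (semiconj_u₁_conj_translation p.1.2.2)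
  rw [q, extraspecial, perm, ← mul_assoc, h.eq, mul_assoc, ← mul_assoc (u₁ 2), u₁_mul_linear]
  rfl

theorem u₂_mul_q (p : Param) : u₂ 2 * q p = q ((p.1.1, (p.1.2.1.1 + p.1.2.1.2, p.1.2.1.2),
    p.1.2.2.swap), (p.2.1.1 + 1, if p.2.1.1 = 0 then p.2.1.2 + 1 else p.2.1.2 - 1), p.2.2) := by
  have h := (SemiconjBy.mul_right (commute_u₂_z.pow_right p.1.1.val)
    (semiconj_u₂_translation p.1.2.1)).mul_right (semiconj_u₂_conj_translation p.1.2.2)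
  rw [q, extraspecial, perm, ← mul_assoc, h.eq, mul_assoc, ← mul_assoc (u₂ 2), u₂_mul_linear]
  rfl

theorem t_mul_q (p : Param) :
    t 2 * q p = q ((p.1.1, (p.1.2.1.1 + 1, p.1.2.1.2), p.1.2.2), p.2) := by
  rw [q, extraspecial, perm, ← mul_assoc, ← mul_assoc (t 2) (_ * _), ← mul_assoc (t 2) (z ^ _),
    (commute_t_z.pow_right p.1.1.val).eq, mul_assoc _ (t 2), t_mul_translation]
  rfl

theorem j_mul_q (p : Param) : j 2 * q p = q
    ((p.1.1 + p.1.2.2.1 * (p.1.2.1.1 + p.1.2.1.2) + p.1.2.2.2 * p.1.2.1.1, p.1.2.2, p.1.2.1),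
      (p.2.1.1, if p.2.1.1 = 0 then -p.2.1.2 else 1 - p.2.1.2), p.2.2 + 1) := by
  rw [q, extraspecial, perm, ← mul_assoc, j_mul_translation_mul, mul_assoc _ (j 2),
    ← mul_assoc (j 2) (linear _), (semiconj_j_linear p.2.1).eq, mul_assoc (linear _), j_mul_j_pow]
  rfl

theorem sgn_q (p : Param) : sgn (q p) = if p.2.1.1 = 0 then 0 else 2 := by
  rw [sgn, decode_q]

theorem exists_mul_q {x : Mono 2} (hx : x ∈ G 2) (p : Param) :
    ∃ p', x * q p = q p' ∧ sgn (x * q p) = sgn x + sgn (q p) := by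
  have flip : ∀ e : Fin 2, (if e + 1 = 0 then 0 else 2 : ZMod 4) = 2 + if e = 0 then 0 else 2 := by
    decide
  have step {g y : Mono 2} (hg : ∀ p, ∃ p', g * q p = q p' ∧ sgn (g * q p) = sgn g + sgn (q p))
      (hy : ∀ p, ∃ p', y * q p = q p' ∧ sgn (y * q p) = sgn y + sgn (q p)) (p : Param) :
      ∃ p', g * y * q p = q p' ∧ sgn (g * y * q p) = sgn (g * y) + sgn (q p) := by
    obtain ⟨p₀, h₀, -⟩ := hy 0
    obtain ⟨p₁, h₁, hs₁⟩ := hy p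
    obtain ⟨p₂, h₂, hs₂⟩ := hg p₁
    rw [q_zero, mul_one] at h₀
    refine ⟨p₂, by rw [mul_assoc, h₁, h₂], ?_⟩
    obtain ⟨-, -, hs₀⟩ := hg p₀
    rw [mul_assoc, h₁, hs₂, ← h₁, hs₁, ← add_assoc, h₀, hs₀, ← h₀]
  have gen {g : Mono 2} (hg : g ∈ ({u₁ 2, u₂ 2, t 2, j 2} : Set (Mono 2))) :
      g⁻¹ = g ∧ ∀ p, ∃ p', g * q p = q p' ∧ sgn (g * q p) = sgn g + sgn (q p) := by
    rcases hg with rfl | rfl | rfl | rfl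
    · refine ⟨by decide +kernel, fun p => ⟨_, u₁_mul_q p, ?_⟩⟩
      rw [u₁_mul_q, sgn_q, sgn_q, show sgn (u₁ 2) = 2 by decide +kernel, flip]
    · refine ⟨by decide +kernel, fun p => ⟨_, u₂_mul_q p, ?_⟩⟩
      rw [u₂_mul_q, sgn_q, sgn_q, show sgn (u₂ 2) = 2 by decide +kernel, flip]
    · refine ⟨by decide +kernel, fun p => ⟨_, t_mul_q p, ?_⟩⟩
      rw [t_mul_q, sgn_q, sgn_q, show sgn (t 2) = 0 by decide +kernel, zero_add]
    · refine ⟨by decide +kernel, fun p => ⟨_, j_mul_q p, ?_⟩⟩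
      rw [j_mul_q, sgn_q, sgn_q, show sgn (j 2) = 0 by decide +kernel, zero_add]
  induction hx using Subgroup.closure_induction_left generalizing p with
  | one => exact ⟨p, one_mul _, by rw [one_mul, show sgn 1 = 0 by decide +kernel, zero_add]⟩
  | mul_left g hg y _ ih => exact step (gen hg).2 ih p
  | inv_mul_cancel g hg y _ ih =>
    rw [(gen hg).1]
    exact step (gen hg).2 ih p

theorem q_decode {x : Mono 2} (hx : x ∈ G 2) : q (decode x) = x := by
  obtain ⟨p, hp, -⟩ := exists_mul_q hx 0
  rw [q_zero, mul_one] at hp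
  rw [hp, decode_q]

theorem sgn_mul {x y : Mono 2} (hx : x ∈ G 2) (hy : y ∈ G 2) : sgn (x * y) = sgn x + sgn y := by
  obtain ⟨-, -, h⟩ := exists_mul_q hx (decode y)
  rwa [q_decode hy] at h

theorem card_G_two : Nat.card (G 2) = 384 := by
  let e : G 2 ≃ Param :=
    { toFun x := decode x
      invFun p := ⟨q p, q_mem p⟩
      left_inv x := by simp only [q_decode x.2]
      right_inv p := by simp only [decode_q] }
  simp [Nat.card_congr e]

end ModTwo

section ModFour

/-- Reduction of the phases modulo `2`. -/
def reduce : Mono 4 →* Mono 2 :=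
  SemidirectProduct.map
    (MonoidHom.compLeft
      (ZMod.castHom (show 2 ∣ 4 by decide) (ZMod 2)).toAddMonoidHom.toMultiplicative (Fin 8))
    (MonoidHom.id _) fun _ => rfl

theorem reduce_u₁ : reduce (u₁ 4) = u₁ 2 := by decide +kernel

theorem reduce_u₂ : reduce (u₂ 4) = u₂ 2 := by decide +kernel

theorem reduce_t : reduce (t 4) = t 2 := by decide +kernel

theorem reduce_j : reduce (j 4) = j 2 := by decide +kernel

theorem reduce_surjective : Function.Surjective reduce := by
  intro x
  refine ⟨⟨fun i => Multiplicative.ofAdd ((x.left i).toAdd.val : ZMod 4), x.right⟩, ?_⟩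
  have h : ∀ a : ZMod 2, ZMod.castHom (show 2 ∣ 4 by decide) (ZMod 2) (a.val : ZMod 4) = a := by
    decide
  exact SemidirectProduct.ext (funext fun i => h (x.left i).toAdd) rfl

theorem map_reduce_G : (G 4).map reduce = G 2 := by
  simp only [G, MonoidHom.map_closure, Set.image_insert_eq, Set.image_singleton, reduce_u₁,
    reduce_u₂, reduce_t, reduce_j]

/-- The reflection in the coordinate `i`. -/
def reflection (i : Fin 8) : Mono 4 :=
  SemidirectProduct.inl (Pi.mulSingle i (Multiplicative.ofAdd 2))

theorem reflection_mem_G (i : Fin 8) : reflection i ∈ G 4 := by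
  have conj {g : Mono 4} (hg : g ∈ G 4) {i i' : Fin 8} (hi : reflection i ∈ G 4)
      (h : g * reflection i * g⁻¹ = reflection i') : reflection i' ∈ G 4 :=
    h ▸ mul_mem (mul_mem hg hi) (inv_mem hg)
  have h₁ : reflection 1 ∈ G 4 := by
    rw [show reflection 1 =
      u₁ 4 * u₂ 4 * u₁ 4 * t 4 ^ 3 * u₁ 4 * u₂ 4 * t 4 * u₁ 4 * t 4 by decide +kernel]
    exact mul_mem (mul_mem (mul_mem (mul_mem (mul_mem (mul_mem (mul_mem (mul_mem u₁_mem_G u₂_mem_G)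
      u₁_mem_G) (pow_mem t_mem_G 3)) u₁_mem_G) u₂_mem_G) t_mem_G) u₁_mem_G) t_mem_G
  have h₃ : reflection 3 ∈ G 4 := conj u₂_mem_G h₁ (by decide +kernel)
  have h₂ : reflection 2 ∈ G 4 := conj u₁_mem_G h₃ (by decide +kernel)
  have h₅ : reflection 5 ∈ G 4 := conj j_mem_G h₁ (by decide +kernel)
  have h₄ : reflection 4 ∈ G 4 := conj t_mem_G h₅ (by decide +kernel)
  fin_cases i
  · exact conj j_mem_G h₄ (by decide +kernel)
  · exact h₁
  · exact h₂
  · exact h₃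
  · exact h₄
  · exact h₅
  · exact conj j_mem_G h₂ (by decide +kernel)
  · exact conj j_mem_G h₃ (by decide +kernel)

theorem ker_reduce_le_G : reduce.ker ≤ G 4 := by
  intro x hx
  have hl : ∀ i, x.left i = 1 ∨ x.left i = Multiplicative.ofAdd 2 := by
    have h : ∀ a : ZMod 4, ZMod.castHom (show 2 ∣ 4 by decide) (ZMod 2) a = 0 → a = 0 ∨ a = 2 := by
      decide
    exact fun i => h _ (congrFun (congrArg SemidirectProduct.left hx) i)
  have hr : x.right = 1 := congrArg SemidirectProduct.right hx
  have : x.left ∈ (G 4).comap SemidirectProduct.inl := by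
    rw [← Finset.univ_prod_mulSingle x.left]
    refine prod_mem fun i _ => ?_
    rcases hl i with h | h
    · rw [h, Pi.mulSingle_one]
      exact one_mem _
    · rw [h]
      exact reflection_mem_G i
  rw [← SemidirectProduct.inl_left_mul_inr_right x, hr, map_one, mul_one]
  exact this

theorem card_G : Nat.card (G 4) = 98304 := by
  have h : (G 4).index = (G 2).index := by
    rw [← Subgroup.index_comap_of_surjective _ reduce_surjective, ← map_reduce_G,
      Subgroup.comap_map_eq_self ker_reduce_le_G]
  have h₂ := (G 2).card_mul_index
  have h₄ := (G 4).card_mul_index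
  rw [card_G_two, card_mono] at h₂
  rw [h, card_mono] at h₄
  have : (G 2).index = 26880 := by omega
  rw [this] at h₄
  exact Nat.eq_of_mul_eq_mul_right (by norm_num) (h₄.trans (by norm_num))

/-- The sum of the phases; it is the logarithm of the determinant up to the sign of the
permutation. -/
def phase (x : Mono 4) : ZMod 4 := ∑ i, (x.left i).toAdd

theorem phase_mul (x y : Mono 4) : phase (x * y) = phase x + phase y := by
  rw [phase, phase, phase, ← Equiv.sum_comp x.right.symm fun i => (y.left i).toAdd,
    ← Finset.sum_add_distrib]
  rfl

/-- On `G 4` this is the homomorphism with kernel `H 4`. -/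
def chi (x : Mono 4) : ZMod 4 := phase x + sgn (reduce x)

theorem reduce_mem_G {x : Mono 4} (hx : x ∈ G 4) : reduce x ∈ G 2 :=
  map_reduce_G ▸ Subgroup.mem_map_of_mem reduce hx

theorem chi_mul {x y : Mono 4} (hx : x ∈ G 4) (hy : y ∈ G 4) : chi (x * y) = chi x + chi y := by
  rw [chi, chi, chi, phase_mul, map_mul, sgn_mul (reduce_mem_G hx) (reduce_mem_G hy)]
  ring

theorem chi_eq_zero {x : Mono 4} (hx : x ∈ H 4) : chi x = 0 := by
  have h₁ : chi 1 = 0 := by decide +kernel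
  induction hx using Subgroup.closure_induction with
  | mem x hx => rcases hx with rfl | rfl | rfl | rfl <;> decide +kernel
  | one => exact h₁
  | mul x y hx hy ihx ihy => rw [chi_mul (H_le_G hx) (H_le_G hy), ihx, ihy, add_zero]
  | inv x hx ih =>
    have h := chi_mul (inv_mem (H_le_G hx)) (H_le_G hx)
    rwa [inv_mul_cancel, h₁, ih, add_zero, eq_comm] at h

theorem u₁_notMem_H : u₁ 4 ∉ H 4 := by
  have : chi (u₁ 4) ≠ 0 := by decide +kernel
  exact fun h => this (chi_eq_zero h)

theorem u₁_mul_u₁ : u₁ 4 * u₁ 4 = 1 := by decide +kernel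

theorem u₁_mul_mul_u₁_mem_H {x : Mono 4} (hx : x ∈ H 4) : u₁ 4 * x * u₁ 4 ∈ H 4 := by
  have hA := u₁_mul_u₂_mem_H (n := 4)
  have hB := u₁_mul_t_mem_H (n := 4)
  have hC := u₂_mul_t_mem_H (n := 4)
  have hj := j_mem_H (n := 4)
  induction hx using Subgroup.closure_induction with
  | mem x hx =>
    rcases hx with rfl | rfl | rfl | rfl
    · rw [show u₁ 4 * (u₁ 4 * u₂ 4) * u₁ 4 = (u₁ 4 * u₂ 4)⁻¹ by decide +kernel]
      exact inv_mem hA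
    · rw [show u₁ 4 * (u₁ 4 * t 4) * u₁ 4 = (u₂ 4 * t 4) ^ 2 * (u₁ 4 * t 4)⁻¹ by decide +kernel]
      exact mul_mem (pow_mem hC 2) (inv_mem hB)
    · rw [show u₁ 4 * (u₂ 4 * t 4) * u₁ 4 =
        u₁ 4 * u₂ 4 * ((u₂ 4 * t 4) ^ 2 * (u₁ 4 * t 4)⁻¹) by decide +kernel]
      exact mul_mem hA (mul_mem (pow_mem hC 2) (inv_mem hB))
    · rw [show u₁ 4 * j 4 * u₁ 4 = j 4 * (u₁ 4 * u₂ 4)⁻¹ by decide +kernel]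
      exact mul_mem hj (inv_mem hA)
  | one => simp [u₁_mul_u₁, one_mem]
  | mul x y _ _ ihx ihy =>
    rw [show u₁ 4 * (x * y) * u₁ 4 = u₁ 4 * x * (u₁ 4 * u₁ 4) * y * u₁ 4 by
      rw [u₁_mul_u₁]; group]
    simpa only [mul_assoc] using mul_mem ihx ihy
  | inv x _ ih =>
    have h := inv_mem ih
    rwa [_root_.mul_inv_rev, _root_.mul_inv_rev, inv_eq_of_mul_eq_one_left u₁_mul_u₁,
      ← mul_assoc] at h

theorem mem_H_or_u₁_mul_mem_H {x : Mono 4} (hx : x ∈ G 4) : x ∈ H 4 ∨ u₁ 4 * x ∈ H 4 := by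
  induction hx using Subgroup.closure_induction with
  | mem x hx =>
    rcases hx with rfl | rfl | rfl | rfl
    · exact .inr (u₁_mul_u₁ ▸ one_mem _)
    · exact .inr u₁_mul_u₂_mem_H
    · exact .inr u₁_mul_t_mem_H
    · exact .inl j_mem_H
  | one => exact .inl (one_mem _)
  | mul x y _ _ ihx ihy =>
    rcases ihx with hx | hx <;> rcases ihy with hy | hy
    · exact .inl (mul_mem hx hy)
    · right
      have h := mul_mem (u₁_mul_mul_u₁_mem_H hx) hy
      rwa [show u₁ 4 * x * u₁ 4 * (u₁ 4 * y) = u₁ 4 * x * (u₁ 4 * u₁ 4) * y by group,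
        u₁_mul_u₁, mul_one, mul_assoc] at h
    · exact .inr (mul_assoc (u₁ 4) x y ▸ mul_mem hx hy)
    · left
      have h := mul_mem (u₁_mul_mul_u₁_mem_H hx) hy
      rwa [show u₁ 4 * (u₁ 4 * x) * u₁ 4 * (u₁ 4 * y) =
        (u₁ 4 * u₁ 4) * x * (u₁ 4 * u₁ 4) * y by group, u₁_mul_u₁, one_mul, mul_one] at h
  | inv x _ ih =>
    rcases ih with hx | hx
    · exact .inl (inv_mem hx)
    · right
      have h := u₁_mul_mul_u₁_mem_H (inv_mem hx)
      rwa [_root_.mul_inv_rev, mul_assoc, mul_assoc, inv_mul_cancel, mul_one] at h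

theorem relIndex_H_G : (H 4).relIndex (G 4) = 2 := by
  rw [Subgroup.relIndex_eq_two_iff_exists_notMem_and']
  exact ⟨u₁ 4, u₁_mem_G, u₁_notMem_H, fun x hx => (mem_H_or_u₁_mul_mem_H hx).symm⟩

theorem card_H : Nat.card (H 4) = 49152 := by
  have h := ((H 4).subgroupOf (G 4)).card_mul_index
  rw [Nat.card_congr (Subgroup.subgroupOfEquivOfLe H_le_G).toEquiv, ← Subgroup.relIndex,
    relIndex_H_G, card_G] at h
  omega

/-- The scalar matrix with phase `1 : ℤ/4`. -/
def scalarI : Mono 4 := ⟨fun _ => Multiplicative.ofAdd 1, 1⟩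

theorem orderOf_scalarI : orderOf scalarI = 4 :=
  orderOf_eq_prime_pow (p := 2) (n := 1) (by decide +kernel) (by decide +kernel)

theorem scalarI_mem_H : scalarI ∈ H 4 := by
  rw [show scalarI = ((u₁ 4 * t 4) ^ 3 * j 4 * (u₂ 4 * t 4) ^ 3 * j 4) ^ 2 by decide +kernel]
  exact pow_mem (mul_mem (mul_mem (mul_mem (pow_mem u₁_mul_t_mem_H 3) j_mem_H)
    (pow_mem u₂_mul_t_mem_H 3)) j_mem_H) 2

end ModFour

section Matrix

/-- The diagonal change of coordinates making the nonzero entries of `J` equal to `1`. -/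
def weight (i : Fin 8) : ℂ := if i < 4 then (Real.sqrt 2 : ℂ) else 1

theorem weight_ne_zero (i : Fin 8) : weight i ≠ 0 := by
  unfold weight
  split_ifs <;> simp

theorem I_pow_val_add (a b : ZMod 4) : I ^ (a + b).val = I ^ a.val * I ^ b.val := by
  rw [ZMod.val_add, ← pow_add, ← Complex.I_pow_eq_pow_mod]

/-- The matrix of an element of `Mono 4`, phases being powers of `i`. -/
def toMatrix : Mono 4 →* Matrix (Fin 8) (Fin 8) ℂ where
  toFun x := Matrix.of fun i k =>
    if x.right k = i then weight i * I ^ (x.left i).toAdd.val / weight k else 0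
  map_one' := by
    ext i k
    by_cases h : k = i
    · subst h
      simp [weight_ne_zero]
    · simp [h, Ne.symm h]
  map_mul' x y := by
    ext i k
    simp only [Matrix.mul_apply, Matrix.of_apply]
    rw [Finset.sum_eq_single (y.right k)]
    · by_cases h : x.right (y.right k) = i
      · subst h
        have hl : (x * y).left (x.right (y.right k)) =
            x.left (x.right (y.right k)) * y.left (y.right k) :=
          congrArg (fun i => x.left _ * y.left i) (x.right.symm_apply_apply _)
        have := weight_ne_zero (y.right k)
        simp only [hl, toAdd_mul, I_pow_val_add, SemidirectProduct.mul_right,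
          Equiv.Perm.mul_apply, if_true]
        field_simp
      · simp [h]
    · intro l _ hl
      simp [Ne.symm hl]
    · simp

theorem toMatrix_eq_mkM {x : Mono 4} {σ : Fin 8 → Fin 8} {c : Fin 8 → ℂ}
    (hσ : ∀ i, x.right (σ i) = i)
    (hc : ∀ i, weight i * I ^ (x.left i).toAdd.val / weight (σ i) = c i) :
    toMatrix x = mkM σ c := by
  ext i k
  have : x.right k = i ↔ k = σ i := by
    rw [← x.right.injective.eq_iff (a := k), hσ]
  simp only [toMatrix, mkM, MonoidHom.coe_mk, OneHom.coe_mk, Matrix.of_apply, this]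
  split_ifs with h
  · rw [h, hc]
  · rfl

theorem toMatrix_u₁ : toMatrix (u₁ 4) = U1M :=
  toMatrix_eq_mkM (by decide) (by simp [Fin.forall_fin_succ, weight, u₁])

theorem toMatrix_u₂ : toMatrix (u₂ 4) = U2M :=
  toMatrix_eq_mkM (by decide) (by simp [Fin.forall_fin_succ, weight, u₂])

theorem toMatrix_t : toMatrix (t 4) = TM :=
  toMatrix_eq_mkM (by decide) (by simp [Fin.forall_fin_succ, weight, t, neg_div])

theorem toMatrix_j : toMatrix (j 4) = JM := by
  have h : (Real.sqrt 2 : ℂ)⁻¹ = (Real.sqrt 2 : ℂ) / 2 := by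
    have : (Real.sqrt 2 : ℂ) ^ 2 = 2 := mod_cast Real.sq_sqrt zero_le_two
    field_simp
    exact this.symm
  exact toMatrix_eq_mkM (by decide) (by simp [Fin.forall_fin_succ, weight, j, h])

theorem toMatrix_scalarI : toMatrix scalarI = iI := by
  ext i k
  by_cases h : k = i
  · subst h
    simp [toMatrix, iI, scalarI, weight_ne_zero, ZMod.val_one'' (show 4 ≠ 1 by decide)]
  · simp [toMatrix, iI, scalarI, h, Ne.symm h]

theorem toMatrix_injective : Function.Injective toMatrix := by
  intro x y h
  have entry (k : Fin 8) := congrFun (congrFun h (x.right k)) k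
  have hr (k : Fin 8) : y.right k = x.right k := by
    by_contra hk
    simpa [toMatrix, hk, weight_ne_zero] using entry k
  refine SemidirectProduct.ext (funext fun i => ?_) (Equiv.ext fun k => (hr k).symm)
  obtain ⟨k, rfl⟩ := x.right.surjective i
  have hk := entry k
  simp only [toMatrix, MonoidHom.coe_mk, OneHom.coe_mk, Matrix.of_apply, hr, if_true] at hk
  rw [div_left_inj' (weight_ne_zero k), mul_right_inj' (weight_ne_zero _)] at hk
  exact Multiplicative.toAdd.injective (ZMod.val_injective 4
    (isPrimitiveRoot_I.pow_inj (ZMod.val_lt _) (ZMod.val_lt _) hk))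

/-- The embedding of `Mono 4` into `GL(8, ℂ)`. -/
def toGL : Mono 4 →* GL (Fin 8) ℂ := toMatrix.toHomUnits

theorem coe_toGL (x : Mono 4) : (toGL x : Matrix (Fin 8) (Fin 8) ℂ) = toMatrix x := rfl

theorem toGL_injective : Function.Injective toGL := fun _ _ h =>
  toMatrix_injective (congrArg Units.val h)

theorem coe_eq_toMatrix_iff {g : GL (Fin 8) ℂ} {x : Mono 4} :
    (g : Matrix (Fin 8) (Fin 8) ℂ) = toMatrix x ↔ g = toGL x := by
  rw [← coe_toGL, Units.ext_iff]

theorem map_toGL_G : (G 4).map toGL = GG := by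
  simp only [G, GG, MonoidHom.map_closure, Set.image_insert_eq, Set.image_singleton,
    ← toMatrix_u₁, ← toMatrix_u₂, ← toMatrix_t, ← toMatrix_j, coe_eq_toMatrix_iff]
  rfl

theorem map_toGL_H : (H 4).map toGL = HH := by
  simp only [H, HH, MonoidHom.map_closure, Set.image_insert_eq, Set.image_singleton,
    ← toMatrix_u₁, ← toMatrix_u₂, ← toMatrix_t, ← toMatrix_j, ← map_mul, coe_eq_toMatrix_iff]
  rfl

theorem map_toGL_zpowers_scalarI : (Subgroup.zpowers scalarI).map toGL = ZZ := by
  simp only [ZZ, Subgroup.zpowers_eq_closure, MonoidHom.map_closure, Set.image_singleton,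
    ← toMatrix_scalarI, coe_eq_toMatrix_iff]
  rfl

end Matrix

end Monomial

open Monomial in
/-- `ℋ` is a subgroup of index `2` in `𝒢`, contains `i·I₈`, has order `49152 = 2¹⁴·3`,
and `ℋ̄ = ℋ/𝒵` has order `12288 = 2¹²·3`. -/
theorem statement1 :
    HH ≤ GG ∧
    (HH.subgroupOf GG).index = 2 ∧
    (∃ g : GL (Fin 8) ℂ, (↑g : Matrix (Fin 8) (Fin 8) ℂ) = iI ∧ g ∈ HH) ∧
    Nat.card HH = 49152 ∧
    Nat.card (HH ⧸ ZZ.subgroupOf HH) = 12288 := by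
  have hH : Nat.card HH = 49152 := by
    rw [← map_toGL_H, Subgroup.card_map_of_injective toGL_injective, card_H]
  have hZ : Nat.card ZZ = 4 := by
    rw [← map_toGL_zpowers_scalarI, Subgroup.card_map_of_injective toGL_injective,
      Nat.card_zpowers, orderOf_scalarI]
  have hZH : ZZ ≤ HH := by
    rw [← map_toGL_zpowers_scalarI, ← map_toGL_H]
    exact Subgroup.map_mono (Subgroup.zpowers_le.2 scalarI_mem_H)
  refine ⟨?_, ?_, ⟨toGL scalarI, toMatrix_scalarI, ?_⟩, hH, ?_⟩
  · rw [← map_toGL_H, ← map_toGL_G]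
    exact Subgroup.map_mono H_le_G
  · rw [← map_toGL_H, ← map_toGL_G]
    exact (Subgroup.relIndex_map_map_of_injective _ _ toGL_injective).trans relIndex_H_G
  · rw [← map_toGL_H]
    exact Subgroup.mem_map_of_mem _ scalarI_mem_H
  · have h := Subgroup.card_eq_card_quotient_mul_card_subgroup (ZZ.subgroupOf HH)
    rw [hH, Nat.card_congr (Subgroup.subgroupOfEquivOfLe hZH).toEquiv, hZ] at h
    omega
end
end

section
/- The singular locus of 𝒳 consists of exactly 96 points; that is, the set of points [v] of complex projective 7-space ℙ⁷(ℂ) such that a (equivalently, every) nonzero representative v = (Y₀,Y₁,Y₂,Y₃,X₀,X₁,X₂,X₃) satisfies the four quadric equations q₀ = q₁ = q₂ = q₃ = 0 and the 4×8 Jacobian matrix (∂qᵢ/∂(coordinate)) evaluated at v has rank at most 3, has cardinality 96. -/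
noncomputable section

open Matrix

/-- Sign matrix: the coefficient of `Xₖ²` in the quadric `qᵢ` is `sgn i k`. -/
def sgn : Matrix (Fin 4) (Fin 4) ℂ := !![1,1,1,1; 1,-1,1,-1; 1,1,-1,-1; 1,-1,-1,1]

/-- The coordinate `Yᵢ` of a vector `v ∈ ℂ⁸`. -/
def yIdx (k : Fin 4) : Fin 8 := ⟨k, by omega⟩
/-- The coordinate `Xᵢ` of a vector `v ∈ ℂ⁸`. -/
def xIdx (k : Fin 4) : Fin 8 := ⟨(k : ℕ) + 4, by omega⟩

/-- The four quadrics `qᵢ = Yᵢ² − Σₖ sgn i k · Xₖ²` defining `𝒳`. -/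
def quadric (i : Fin 4) (v : Fin 8 → ℂ) : ℂ :=
  v (yIdx i) ^ 2 - ∑ k : Fin 4, sgn i k * v (xIdx k) ^ 2

/-- The `4×8` Jacobian matrix of the four quadrics at `v`:
`∂qᵢ/∂Yⱼ = 2Yᵢ` if `j = i` (and `0` otherwise), `∂qᵢ/∂Xₖ = −2·sgn i k·Xₖ`. -/
def jacQ (v : Fin 8 → ℂ) : Matrix (Fin 4) (Fin 8) ℂ :=
  Matrix.of fun i j =>
    if hj : (j : ℕ) < 4 then (if (j : ℕ) = (i : ℕ) then 2 * v j else 0)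
    else (-2) * sgn i ⟨(j : ℕ) - 4, by omega⟩ * v j

/-- The integral form of `sgn`. -/
def sgnInt : Matrix (Fin 4) (Fin 4) ℤ := !![1,1,1,1; 1,-1,1,-1; 1,1,-1,-1; 1,-1,-1,1]

lemma sgn_eq_intCast (i k : Fin 4) : sgn i k = (sgnInt i k : ℂ) := by
  fin_cases i <;> fin_cases k <;> simp [sgn, sgnInt]

/-- `a` is a linear relation between the rows of the Jacobian matrix at `v`. -/
def IsRowRelation (v : Fin 8 → ℂ) (a : Fin 4 → ℂ) : Prop :=
  (∀ l, a l * v (yIdx l) = 0) ∧ ∀ k, (∑ l, a l * sgn l k) * v (xIdx k) = 0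

lemma forall_coord_iff {P : Fin 8 → Prop} :
    (∀ m, P m) ↔ (∀ l, P (yIdx l)) ∧ ∀ k, P (xIdx k) := by
  refine ⟨fun h => ⟨fun l => h _, fun k => h _⟩, fun ⟨hy, hx⟩ m => ?_⟩
  by_cases hm : (m : ℕ) < 4
  · exact hy ⟨m, hm⟩
  · convert hx ⟨m - 4, by omega⟩
    simp only [xIdx, Fin.ext_iff]
    omega

lemma jacQ_yIdx (v : Fin 8 → ℂ) (i l : Fin 4) :
    jacQ v i (yIdx l) = if l = i then 2 * v (yIdx l) else 0 := by
  simp [jacQ, yIdx, Fin.ext_iff]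

lemma jacQ_xIdx (v : Fin 8 → ℂ) (i k : Fin 4) :
    jacQ v i (xIdx k) = -2 * sgn i k * v (xIdx k) := by
  simp [jacQ, xIdx]

lemma sum_smul_jacQ_eq_zero_iff (v : Fin 8 → ℂ) (a : Fin 4 → ℂ) :
    ∑ i, a i • (jacQ v).row i = 0 ↔ IsRowRelation v a := by
  rw [funext_iff, IsRowRelation, forall_coord_iff]
  simp only [Finset.sum_apply, Pi.smul_apply, Matrix.row, jacQ_yIdx, jacQ_xIdx, smul_eq_mul,
    Pi.zero_apply]
  refine and_congr (forall_congr' fun l => ?_) (forall_congr' fun k => ?_)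
  · simp
  · rw [show ∑ i, a i * (-2 * sgn i k * v (xIdx k)) = -2 * ((∑ i, a i * sgn i k) * v (xIdx k)) by
      rw [Finset.sum_mul, Finset.mul_sum]
      exact Finset.sum_congr rfl fun i _ => by ring]
    simp

lemma rank_jacQ_le_three_iff (v : Fin 8 → ℂ) :
    (jacQ v).rank ≤ 3 ↔ ∃ a, IsRowRelation v a ∧ a ≠ 0 := by
  have h : LinearIndependent ℂ (jacQ v).row ↔ 4 = (jacQ v).rank := by
    rw [linearIndependent_iff_card_eq_finrank_span, Matrix.rank_eq_finrank_span_row]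
    simp [Set.finrank]
  have h4 : (jacQ v).rank ≤ 4 := by simpa using (jacQ v).rank_le_card_height
  have : (jacQ v).rank ≤ 3 ↔ ¬ LinearIndependent ℂ (jacQ v).row := by rw [h]; omega
  rw [this, Fintype.not_linearIndependent_iff]
  simp only [sum_smul_jacQ_eq_zero_iff, Function.ne_iff, Pi.zero_apply]

/-- `v` satisfies the four equations, and the Jacobian matrix is degenerate at `v`. -/
def IsSingular (v : Fin 8 → ℂ) : Prop :=
  (∀ i, quadric i v = 0) ∧ (jacQ v).rank ≤ 3

lemma IsSingular.smul {v : Fin 8 → ℂ} (hv : IsSingular v) (c : ℂ) : IsSingular (c • v) := by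
  obtain ⟨hq, hr⟩ := hv
  rw [rank_jacQ_le_three_iff] at hr
  obtain ⟨a, ⟨hy, hx⟩, ha⟩ := hr
  refine ⟨fun i => ?_, (rank_jacQ_le_three_iff _).2 ⟨a, ⟨fun l => ?_, fun k => ?_⟩, ha⟩⟩
  · have := hq i
    simp only [quadric, Fin.sum_univ_four, Pi.smul_apply, smul_eq_mul] at this ⊢
    linear_combination c ^ 2 * this
  · simp only [Pi.smul_apply, smul_eq_mul]
    linear_combination c * hy l
  · simp only [Pi.smul_apply, smul_eq_mul]
    linear_combination c * hx k

lemma exists_pair_support (x a : Fin 4 → ℂ) (hx : x ≠ 0) (ha : a ≠ 0)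
    (hy : ∀ l, a l * ∑ k, sgn l k * x k = 0) (hb : ∀ k, (∑ l, a l * sgn l k) * x k = 0) :
    ∃ i j, i < j ∧ x i ≠ 0 ∧ x j ^ 2 = x i ^ 2 ∧ ∀ k, k ≠ i → k ≠ j → x k = 0 := by
  obtain ⟨x0, x1, x2, x3, rfl⟩ : ∃ p q r s, x = ![p, q, r, s] :=
    ⟨x 0, x 1, x 2, x 3, by ext k; fin_cases k <;> rfl⟩
  obtain ⟨a0, a1, a2, a3, rfl⟩ : ∃ p q r s, a = ![p, q, r, s] :=
    ⟨a 0, a 1, a 2, a 3, by ext k; fin_cases k <;> rfl⟩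
  simp [Fin.forall_fin_succ, Fin.exists_fin_succ, Fin.sum_univ_four, sgn, -mul_eq_zero]
    at hx ha hy hb ⊢
  grind

/-- The point with `Xᵢ = 1`, `Xⱼ = Iᶜ`, the other `Xₖ` zero, and `Yₗ` the square root of
`sgn l i + sgn l j * (-1)ᶜ` selected by `ε l`. -/
def singPoint (i j c : Fin 4) (ε : Fin 4 → Bool) : Fin 8 → ℂ :=
  Fin.append (m := 4) (n := 4)
    (fun l => (if ε l then 1 else -1) *
      if sgnInt l i * sgnInt l j = (-1) ^ (c : ℕ) then
        (if sgnInt l i = 1 then (√2 : ℂ) else √2 * Complex.I) else 0)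
    (fun k => if k = i then 1 else if k = j then Complex.I ^ (c : ℕ) else 0)

lemma singPoint_yIdx (i j c : Fin 4) (ε : Fin 4 → Bool) (l : Fin 4) :
    singPoint i j c ε (yIdx l) = (if ε l then 1 else -1) *
      if sgnInt l i * sgnInt l j = (-1) ^ (c : ℕ) then
        (if sgnInt l i = 1 then (√2 : ℂ) else √2 * Complex.I) else 0 :=
  Fin.append_left (m := 4) (n := 4) _ _ l

lemma singPoint_xIdx (i j c : Fin 4) (ε : Fin 4 → Bool) (k : Fin 4) :
    singPoint i j c ε (xIdx k) =
      if k = i then 1 else if k = j then Complex.I ^ (c : ℕ) else 0 := by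
  rw [show xIdx k = Fin.natAdd 4 k by ext; simp [xIdx]]
  exact Fin.append_right (m := 4) (n := 4) _ _ k

lemma sqrt_two_sq : (√2 : ℂ) ^ 2 = 2 := by
  exact_mod_cast Real.sq_sqrt zero_le_two

lemma sgnInt_eq (i k : Fin 4) : sgnInt i k = 1 ∨ sgnInt i k = -1 := by
  fin_cases i <;> fin_cases k <;> simp [sgnInt]

lemma sum_mul_ite_pair {i j : Fin 4} (hij : i ≠ j) (f : Fin 4 → ℂ) (p q : ℂ) :
    ∑ k, f k * (if k = i then p else if k = j then q else 0) = f i * p + f j * q := by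
  rw [Finset.sum_eq_add i j hij] <;> simp +contextual [hij.symm]

lemma singPoint_yIdx_sq (i j c : Fin 4) (ε : Fin 4 → Bool) (l : Fin 4) :
    singPoint i j c ε (yIdx l) ^ 2 = sgn l i + sgn l j * (-1) ^ (c : ℕ) := by
  rw [singPoint_yIdx, sgn_eq_intCast, sgn_eq_intCast, mul_pow, ite_pow]
  have hε : (if ε l then (1 : ℂ) ^ 2 else (-1) ^ 2) = 1 := by simp
  rw [hε]
  have hc : ((-1) ^ (c : ℕ) : ℤ) = 1 ∨ ((-1) ^ (c : ℕ) : ℤ) = -1 := neg_one_pow_eq_or ℤ c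
  rw [show ((-1) ^ (c : ℕ) : ℂ) = (((-1) ^ (c : ℕ) : ℤ) : ℂ) by push_cast; rfl]
  rcases sgnInt_eq l i with hi | hi <;> rcases sgnInt_eq l j with hj | hj <;>
    rcases hc with hc | hc <;> simp [hi, hj, hc, mul_pow, sqrt_two_sq] <;> norm_num

lemma quadric_singPoint {i j : Fin 4} (hij : i ≠ j) (c : Fin 4) (ε : Fin 4 → Bool) (l : Fin 4) :
    quadric l (singPoint i j c ε) = 0 := by
  have h : ∀ k, singPoint i j c ε (xIdx k) ^ 2 =
      if k = i then 1 else if k = j then (-1) ^ (c : ℕ) else 0 := by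
    intro k
    rw [singPoint_xIdx]
    split_ifs <;> simp [← pow_mul, mul_comm _ 2]
    simp [pow_mul]
  rw [quadric, singPoint_yIdx_sq]
  simp only [h, sum_mul_ite_pair hij]
  ring

lemma exists_sgnInt_relation (i j : Fin 4) (hij : i ≠ j) (c : Fin 4) :
    ∃ a : Fin 4 → Fin 3, a ≠ 1 ∧
      (∀ l, sgnInt l i * sgnInt l j = (-1) ^ (c : ℕ) → a l = 1) ∧
      ∑ l, ((a l : ℕ) - 1 : ℤ) * sgnInt l i = 0 ∧ ∑ l, ((a l : ℕ) - 1 : ℤ) * sgnInt l j = 0 := by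
  revert i j c
  decide +kernel

lemma isSingular_singPoint {i j : Fin 4} (hij : i ≠ j) (c : Fin 4) (ε : Fin 4 → Bool) :
    IsSingular (singPoint i j c ε) := by
  refine ⟨quadric_singPoint hij c ε, (rank_jacQ_le_three_iff _).2 ?_⟩
  obtain ⟨a, ha, hy, hi, hj⟩ := exists_sgnInt_relation i j hij c
  refine ⟨fun l => ((a l : ℕ) - 1 : ℤ), ⟨fun l => ?_, fun k => ?_⟩, ?_⟩
  · rw [singPoint_yIdx]
    split_ifs with h1 h2 <;> simp_all
  · rw [singPoint_xIdx]
    simp only [sgn_eq_intCast]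
    split_ifs with h1 h2
    · subst h1; rw [mul_one]; exact_mod_cast hi
    · subst h2; rw [mul_eq_zero]; left; exact_mod_cast hj
    · simp
  · contrapose! ha
    ext l
    have := congrFun ha l
    simp only [Pi.zero_apply, Int.cast_eq_zero] at this
    simp
    omega

/-- Indices `(i, j, c, ε)` for `singPoint`; the irrelevant signs in `ε` are normalized. -/
def singIndex : Finset (Fin 4 × Fin 4 × Fin 4 × (Fin 4 → Bool)) :=
  Finset.univ.filter fun t => t.1 < t.2.1 ∧
    ∀ l, sgnInt l t.1 * sgnInt l t.2.1 ≠ (-1) ^ (t.2.2.1 : ℕ) → t.2.2.2 l = true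

lemma card_singIndex : singIndex.card = 96 := by
  decide +kernel

lemma singPoint_ne_zero (i j c : Fin 4) (ε : Fin 4 → Bool) : singPoint i j c ε ≠ 0 := by
  intro h
  have := congrFun h (xIdx i)
  simp [singPoint_xIdx] at this

/-- The point of `ℙ⁷(ℂ)` represented by `singPoint`. -/
def singProj (t : Fin 4 × Fin 4 × Fin 4 × (Fin 4 → Bool)) : Projectivization ℂ (Fin 8 → ℂ) :=
  .mk ℂ (singPoint t.1 t.2.1 t.2.2.1 t.2.2.2) (singPoint_ne_zero _ _ _ _)

lemma I_pow_injective {c d : Fin 4} (h : Complex.I ^ (c : ℕ) = Complex.I ^ (d : ℕ)) : c = d := by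
  have h4 : IsPrimitiveRoot Complex.I 4 := Complex.isPrimitiveRoot_I
  exact Fin.ext (h4.pow_inj c.2 d.2 h)

lemma ite_pair_ne_zero_iff (i j c k : Fin 4) :
    (if k = i then 1 else if k = j then Complex.I ^ (c : ℕ) else 0) ≠ 0 ↔ k = i ∨ k = j := by
  split_ifs <;> simp_all

lemma singProj_injOn : Set.InjOn singProj singIndex := by
  rintro ⟨i, j, c, ε⟩ h ⟨i', j', c', ε'⟩ h' heq
  simp only [singIndex, Finset.coe_filter, Finset.mem_univ, true_and, Set.mem_ofPred_eq] at h h'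
  obtain ⟨hij, hε⟩ := h
  obtain ⟨hij', hε'⟩ := h'
  simp only [singProj, Projectivization.mk_eq_mk_iff'] at heq
  obtain ⟨r, hr⟩ := heq
  have hX : ∀ k, r * singPoint i' j' c' ε' (xIdx k) = singPoint i j c ε (xIdx k) :=
    fun k => congrFun hr _
  have hY : ∀ l, r * singPoint i' j' c' ε' (yIdx l) = singPoint i j c ε (yIdx l) :=
    fun k => congrFun hr _
  simp only [singPoint_xIdx] at hX
  simp only [singPoint_yIdx] at hY
  have hr0 : r ≠ 0 := by
    rintro rfl
    simpa using hX i
  have hsupp : ∀ k, (k = i' ∨ k = j') ↔ (k = i ∨ k = j) := by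
    intro k
    rw [← ite_pair_ne_zero_iff i' j' c', ← ite_pair_ne_zero_iff i j c, ← hX k, mul_ne_zero_iff]
    simp only [hr0, ne_eq, not_false_eq_true, true_and]
  obtain ⟨rfl, rfl⟩ : i' = i ∧ j' = j := by
    have h1 := (hsupp i').1 (.inl rfl)
    have h2 := (hsupp j').1 (.inr rfl)
    omega
  obtain rfl : r = 1 := by simpa using hX i'
  obtain rfl : c' = c := by
    have := hX j'
    simp only [hij.ne', if_true, if_false, one_mul] at this
    exact I_pow_injective this
  obtain rfl : ε' = ε := by
    ext1 l
    by_cases hl : sgnInt l i' * sgnInt l j' = (-1) ^ (c' : ℕ)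
    · have h2 : (if sgnInt l i' = 1 then (√2 : ℂ) else √2 * Complex.I) ≠ 0 := by
        split_ifs <;> simp
      have := hY l
      rw [if_pos hl, one_mul] at this
      have := mul_right_cancel₀ h2 this
      cases h3 : ε' l <;> cases h4 : ε l <;> simp [h3, h4] at this ⊢ <;> norm_num at this
    · rw [hε l hl, hε' l hl]
  rfl

lemma exists_I_pow {z : ℂ} (hz : z ^ 4 = 1) : ∃ c : Fin 4, z = Complex.I ^ (c : ℕ) := by
  obtain ⟨c, hc, rfl⟩ := Complex.isPrimitiveRoot_I.eq_pow_of_pow_eq_one hz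
  exact ⟨⟨c, hc⟩, rfl⟩

lemma IsSingular.exists_smul_singPoint {v : Fin 8 → ℂ} (hv : IsSingular v) (hv0 : v ≠ 0) :
    ∃ t ∈ singIndex, ∃ r : ℂ, r • singPoint t.1 t.2.1 t.2.2.1 t.2.2.2 = v := by
  obtain ⟨hq, hr⟩ := hv
  obtain ⟨a, ⟨hy, hx⟩, ha⟩ := (rank_jacQ_le_three_iff _).1 hr
  replace hq : ∀ l, v (yIdx l) ^ 2 = ∑ k, sgn l k * v (xIdx k) ^ 2 := fun l =>
    sub_eq_zero.1 (hq l)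
  obtain ⟨i, j, hij, hi, hj, hk⟩ := exists_pair_support (fun k => v (xIdx k) ^ 2) a
    (by
      contrapose! hv0
      have hx0 : ∀ k, v (xIdx k) = 0 := fun k => by simpa using congrFun hv0 k
      rw [funext_iff, forall_coord_iff]
      exact ⟨fun l => by simpa [hx0] using hq l, hx0⟩)
    ha
    (fun l => by rw [← hq l]; linear_combination v (yIdx l) * hy l)
    (fun k => by linear_combination v (xIdx k) * hx k)
  simp only [ne_eq, OfNat.ofNat_ne_zero, not_false_eq_true, pow_eq_zero_iff] at hi hk
  obtain ⟨c, hc⟩ := exists_I_pow (z := v (xIdx j) / v (xIdx i)) (by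
    field_simp
    linear_combination hj)
  set x := v (xIdx i)
  have hxj : v (xIdx j) = x * Complex.I ^ (c : ℕ) := by rw [← hc]; field_simp
  have hX : ∀ k, v (xIdx k) =
      x * if k = i then 1 else if k = j then Complex.I ^ (c : ℕ) else 0 := by
    intro k
    split_ifs with h1 h2
    · rw [h1, mul_one]
    · rw [h2, hxj]
    · rw [hk k h1 h2, mul_zero]
  have hsq : ∀ ε l, v (yIdx l) = x * singPoint i j c ε (yIdx l) ∨
      v (yIdx l) = -(x * singPoint i j c ε (yIdx l)) := by
    intro ε l
    rw [← sq_eq_sq_iff_eq_or_eq_neg, hq, mul_pow]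
    have := quadric_singPoint hij.ne c ε l
    rw [quadric, sub_eq_zero] at this
    rw [this, Finset.mul_sum]
    refine Finset.sum_congr rfl fun k _ => ?_
    rw [hX, singPoint_xIdx]
    ring
  classical
  let ε : Fin 4 → Bool := fun l =>
    decide (v (yIdx l) = x * singPoint i j c (fun _ => true) (yIdx l))
  refine ⟨(i, j, c, ε), ?_, x, ?_⟩
  · simp only [singIndex, Finset.mem_filter, Finset.mem_univ, true_and, hij]
    intro l hl
    have := hsq (fun _ => true) l
    simpa [ε, singPoint_yIdx, hl] using this
  · rw [funext_iff, forall_coord_iff]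
    refine ⟨fun l => ?_, fun k => ?_⟩
    · by_cases hl : v (yIdx l) = x * singPoint i j c (fun _ => true) (yIdx l)
      · have hε : ε l = true := decide_eq_true hl
        rw [hl]
        simp [singPoint_yIdx, hε]
      · have hε : ε l = false := decide_eq_false hl
        rw [(hsq (fun _ => true) l).resolve_left hl, Pi.smul_apply, smul_eq_mul, singPoint_yIdx,
          singPoint_yIdx]
        simp only [hε, Bool.false_eq_true, if_true, if_false]
        ring
    · simp [hX, singPoint_xIdx]

lemma setOf_isSingular_eq_image :
    {p : Projectivization ℂ (Fin 8 → ℂ) | IsSingular p.rep} = singProj '' singIndex := by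
  ext p
  simp only [Set.mem_ofPred_eq, Set.mem_image, SetLike.mem_coe]
  constructor
  · intro hp
    obtain ⟨t, ht, r, hr⟩ := hp.exists_smul_singPoint p.rep_nonzero
    refine ⟨t, ht, ?_⟩
    rw [← p.mk_rep]
    exact ((Projectivization.mk_eq_mk_iff' ..).2 ⟨r, hr⟩).symm
  · rintro ⟨t, ht, rfl⟩
    obtain ⟨r, hr⟩ := Projectivization.exists_smul_eq_mk_rep ℂ _
      (singPoint_ne_zero t.1 t.2.1 t.2.2.1 t.2.2.2)
    rw [singProj, ← hr]
    have hij : t.1 < t.2.1 := (Finset.mem_filter.1 ht).2.1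
    exact (isSingular_singPoint hij.ne _ _).smul _

/-- The singular locus of `𝒳` consists of exactly `96` points: the set of points of
`ℙ⁷(ℂ)` whose representatives satisfy `q₀ = q₁ = q₂ = q₃ = 0` and at which the Jacobian
matrix has rank at most `3` has cardinality `96`. -/
theorem statement4 :
    Nat.card {p : Projectivization ℂ (Fin 8 → ℂ) |
      (∀ i : Fin 4, quadric i p.rep = 0) ∧ (jacQ p.rep).rank ≤ 3} = 96 := by
  change Nat.card {p : Projectivization ℂ (Fin 8 → ℂ) | IsSingular p.rep} = 96
  rw [setOf_isSingular_eq_image, Nat.card_coe_set_eq, singProj_injOn.ncard_image,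
    Set.ncard_coe_finset, card_singIndex]
end
end

section
/- Let G be the subgroup of GL(8,ℂ) generated by the six linear transformations of ℂ⁸ given in coordinates (Y₀,Y₁,Y₂,Y₃,X₀,X₁,X₂,X₃) by (−Y₁, −iY₀, Y₃, −iY₂, −iX₁, X₀, iX₃, X₂), (−iY₂, Y₃, Y₀, iY₁, X₃, −X₂, −iX₁, −iX₀), (−Y₀, Y₁, Y₂, −Y₃, X₀, −X₁, X₂, −X₃), (iY₀, iY₁, iY₂, iY₃, −iX₀, −iX₁, −iX₂, −iX₃), (Y₀, Y₁, −Y₂, −Y₃, X₀, X₁, −X₂, −X₃), (iY₀, iY₁, iY₂, iY₃, iX₀, iX₁, iX₂, iX₃). Then G contains the scalar group 𝒵 generated by i·I₈, G has order 128 (so its image modulo 𝒵 has order 32), and G acts freely on 𝒳: for every g ∈ G and every nonzero v ∈ ℂ⁸ satisfying the four quadric equations, if g·v is a scalar multiple of v then g ∈ 𝒵. -/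
noncomputable section

open Matrix Complex

/-- The affine cone over `𝒳`: solutions of the four quadric equations. -/
def ConeSet : Set (Fin 8 → ℂ) :=
  {v | v 0 ^ 2 = v 4 ^ 2 + v 5 ^ 2 + v 6 ^ 2 + v 7 ^ 2 ∧
       v 1 ^ 2 = v 4 ^ 2 - v 5 ^ 2 + v 6 ^ 2 - v 7 ^ 2 ∧
       v 2 ^ 2 = v 4 ^ 2 + v 5 ^ 2 - v 6 ^ 2 - v 7 ^ 2 ∧
       v 3 ^ 2 = v 4 ^ 2 - v 5 ^ 2 - v 6 ^ 2 + v 7 ^ 2}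

/-- `(−Y₁, −iY₀, Y₃, −iY₂, −iX₁, X₀, iX₃, X₂)` -/
def h1M : Matrix (Fin 8) (Fin 8) ℂ :=
  mkM ![1,0,3,2,5,4,7,6] ![-1, -Complex.I, 1, -Complex.I, -Complex.I, 1, Complex.I, 1]
/-- `(−iY₂, Y₃, Y₀, iY₁, X₃, −X₂, −iX₁, −iX₀)` -/
def h2M : Matrix (Fin 8) (Fin 8) ℂ :=
  mkM ![2,3,0,1,7,6,5,4] ![-Complex.I, 1, 1, Complex.I, 1, -1, -Complex.I, -Complex.I]
/-- `(−Y₀, Y₁, Y₂, −Y₃, X₀, −X₁, X₂, −X₃)` -/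
def h3M : Matrix (Fin 8) (Fin 8) ℂ :=
  Matrix.diagonal ![-1, 1, 1, -1, 1, -1, 1, -1]
/-- `(iY₀, iY₁, iY₂, iY₃, −iX₀, −iX₁, −iX₂, −iX₃)` -/
def h4M : Matrix (Fin 8) (Fin 8) ℂ :=
  Matrix.diagonal ![Complex.I, Complex.I, Complex.I, Complex.I,
    -Complex.I, -Complex.I, -Complex.I, -Complex.I]
/-- `(Y₀, Y₁, −Y₂, −Y₃, X₀, X₁, −X₂, −X₃)` -/
def h5M : Matrix (Fin 8) (Fin 8) ℂ :=
  Matrix.diagonal ![1, 1, -1, -1, 1, 1, -1, -1]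
/-- `(iY₀, iY₁, iY₂, iY₃, iX₀, iX₁, iX₂, iX₃)` -/
def h6M : Matrix (Fin 8) (Fin 8) ℂ :=
  Matrix.diagonal ![Complex.I, Complex.I, Complex.I, Complex.I,
    Complex.I, Complex.I, Complex.I, Complex.I]

/-- The subgroup generated by the six transformations. -/
def G32 : Subgroup (GL (Fin 8) ℂ) :=
  Subgroup.closure {g | (↑g : Matrix (Fin 8) (Fin 8) ℂ) = h1M ∨
    (↑g : Matrix (Fin 8) (Fin 8) ℂ) = h2M ∨ (↑g : Matrix (Fin 8) (Fin 8) ℂ) = h3M ∨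
    (↑g : Matrix (Fin 8) (Fin 8) ℂ) = h4M ∨ (↑g : Matrix (Fin 8) (Fin 8) ℂ) = h5M ∨
    (↑g : Matrix (Fin 8) (Fin 8) ℂ) = h6M}

/-- Monomial `8 × 8` matrices whose nonzero entries are fourth roots of unity: a vector of
exponents of `i` together with a permutation of the coordinates. -/
abbrev Monomial8 : Type :=
  (Fin 8 → Multiplicative (ZMod 4)) ⋊[mulAutArrow] Equiv.Perm (Fin 8)

/-- The character `k ↦ i ^ k` of `ℤ/4`. -/
def powI : Multiplicative (ZMod 4) →* ℂ :=
  (AddChar.zmodChar 4 Complex.I_pow_four).toMonoidHom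

@[simp]
lemma powI_ofAdd_one : powI (Multiplicative.ofAdd 1) = Complex.I := pow_one _

@[simp]
lemma powI_ofAdd_two : powI (Multiplicative.ofAdd 2) = -1 := Complex.I_sq

@[simp]
lemma powI_ofAdd_three : powI (Multiplicative.ofAdd 3) = -Complex.I := by
  rw [show powI (Multiplicative.ofAdd 3) = Complex.I ^ 3 from rfl, pow_succ, Complex.I_sq,
    neg_one_mul]

lemma powI_injective : Function.Injective powI := fun _ _ h =>
  Multiplicative.toAdd.injective <| ZMod.val_injective 4 <|
    Complex.isPrimitiveRoot_I.pow_inj (ZMod.val_lt _) (ZMod.val_lt _) h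

lemma powI_ne_zero (k : Multiplicative (ZMod 4)) : powI k ≠ 0 :=
  pow_ne_zero _ Complex.I_ne_zero

lemma mkM_mul (σ τ : Fin 8 → Fin 8) (c d : Fin 8 → ℂ) :
    mkM σ c * mkM τ d = mkM (τ ∘ σ) fun i => c i * d (σ i) := by
  ext i j
  simp only [mkM, Matrix.mul_apply, Matrix.of_apply, ite_mul, zero_mul, Finset.sum_ite_eq',
    Finset.mem_univ, if_true]
  simp

lemma mkM_mulVec (σ : Fin 8 → Fin 8) (c v : Fin 8 → ℂ) (i : Fin 8) :
    (mkM σ c *ᵥ v) i = c i * v (σ i) := by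
  simp [mkM, Matrix.mulVec, dotProduct]

lemma mkM_id (c : Fin 8 → ℂ) : mkM id c = Matrix.diagonal c := by
  ext i j
  simp [mkM, Matrix.diagonal_apply, eq_comm]

namespace Monomial8

/-- Componentwise comparison, which unlike the derived instance reduces in the kernel. -/
instance : DecidableEq Monomial8 := fun x y =>
  decidable_of_iff (x.left = y.left ∧ x.right = y.right) SemidirectProduct.ext_iff.symm

/-- The matrix of a monomial transformation. -/
def toMatrix : Monomial8 →* Matrix (Fin 8) (Fin 8) ℂ where
  toFun x := mkM ⇑x.right⁻¹ fun i => powI (x.left i)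
  map_one' := by
    simpa using mkM_id fun _ => 1
  map_mul' x y := by
    simp [mkM_mul, Function.comp_def]
    rfl

lemma toMatrix_mulVec (x : Monomial8) (v : Fin 8 → ℂ) (i : Fin 8) :
    (toMatrix x *ᵥ v) i = powI (x.left i) * v (x.right⁻¹ i) :=
  mkM_mulVec _ _ _ _

lemma toMatrix_injective : Function.Injective toMatrix := by
  intro x y h
  have entry (i j) : (if j = x.right⁻¹ i then powI (x.left i) else 0) =
      if j = y.right⁻¹ i then powI (y.left i) else 0 := congrFun (congrFun h i) j
  have hperm (i) : x.right⁻¹ i = y.right⁻¹ i := by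
    by_contra hne
    have := entry i (x.right⁻¹ i)
    rw [if_pos rfl, if_neg hne] at this
    exact powI_ne_zero _ this
  refine SemidirectProduct.ext (funext fun i => powI_injective ?_)
    (inv_injective (Equiv.ext hperm))
  have := entry i (x.right⁻¹ i)
  rwa [if_pos rfl, if_pos (hperm i)] at this

/-- The invertible matrix of a monomial transformation. -/
def toGL : Monomial8 →* GL (Fin 8) ℂ := toMatrix.toHomUnits

@[simp]
lemma coe_toGL (x : Monomial8) : (toGL x : Matrix (Fin 8) (Fin 8) ℂ) = toMatrix x := rfl

lemma toGL_injective : Function.Injective toGL := fun _ _ h =>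
  toMatrix_injective (congrArg Units.val h)

/-- The involution `(Y₁,Y₀,Y₃,Y₂,X₁,X₀,X₃,X₂)` of the coordinates. -/
def swap₁ : Equiv.Perm (Fin 8) where
  toFun := ![1, 0, 3, 2, 5, 4, 7, 6]
  invFun := ![1, 0, 3, 2, 5, 4, 7, 6]
  left_inv := by decide
  right_inv := by decide

/-- The involution `(Y₂,Y₃,Y₀,Y₁,X₃,X₂,X₁,X₀)` of the coordinates. -/
def swap₂ : Equiv.Perm (Fin 8) where
  toFun := ![2, 3, 0, 1, 7, 6, 5, 4]
  invFun := ![2, 3, 0, 1, 7, 6, 5, 4]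
  left_inv := by decide
  right_inv := by decide

/-- The monomial transformations underlying the six generators. -/
def gen : Fin 6 → Monomial8 := ![
  ⟨Multiplicative.ofAdd ∘ ![2, 3, 0, 3, 3, 0, 1, 0], swap₁⟩,
  ⟨Multiplicative.ofAdd ∘ ![3, 0, 0, 1, 0, 2, 3, 3], swap₂⟩,
  ⟨Multiplicative.ofAdd ∘ ![2, 0, 0, 2, 0, 2, 0, 2], 1⟩,
  ⟨Multiplicative.ofAdd ∘ ![1, 1, 1, 1, 3, 3, 3, 3], 1⟩,
  ⟨Multiplicative.ofAdd ∘ ![0, 0, 2, 2, 0, 0, 2, 2], 1⟩,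
  ⟨fun _ => Multiplicative.ofAdd 1, 1⟩]

lemma toMatrix_gen_zero : toMatrix (gen 0) = h1M := by
  refine congrArg (mkM ![1, 0, 3, 2, 5, 4, 7, 6]) (funext fun i => ?_)
  fin_cases i <;> simp [gen]

lemma toMatrix_gen_one : toMatrix (gen 1) = h2M := by
  refine congrArg (mkM ![2, 3, 0, 1, 7, 6, 5, 4]) (funext fun i => ?_)
  fin_cases i <;> simp [gen]

lemma toMatrix_gen_two : toMatrix (gen 2) = h3M := by
  refine (mkM_id _).trans (congrArg Matrix.diagonal (funext fun i => ?_))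
  fin_cases i <;> simp [gen]

lemma toMatrix_gen_three : toMatrix (gen 3) = h4M := by
  refine (mkM_id _).trans (congrArg Matrix.diagonal (funext fun i => ?_))
  fin_cases i <;> simp [gen]

lemma toMatrix_gen_four : toMatrix (gen 4) = h5M := by
  refine (mkM_id _).trans (congrArg Matrix.diagonal (funext fun i => ?_))
  fin_cases i <;> simp [gen]

lemma toMatrix_gen_five : toMatrix (gen 5) = h6M := by
  refine (mkM_id _).trans (congrArg Matrix.diagonal (funext fun i => ?_))
  fin_cases i <;> simp [gen]

/-- Exponents of the six generators in the normal form of an element of the group. -/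
abbrev Exponents : Type := Fin 2 × Fin 2 × Fin 2 × Fin 2 × Fin 2 × Fin 4

/-- The product of powers of the generators with given exponents. -/
def word : Exponents → Monomial8 := fun (a, b, c, d, e, k) =>
  gen 0 ^ a.val * gen 1 ^ b.val * gen 2 ^ c.val * gen 3 ^ d.val * gen 4 ^ e.val * gen 5 ^ k.val

/-- A left inverse of `word`: the permutation determines the exponents of the first two
generators, and the remaining diagonal factor determines the others. -/
def exponents (x : Monomial8) : Exponents :=
  let a : Fin 2 := ![0, 1, 0, 1, 0, 0, 0, 0] (x.right 0)
  let b : Fin 2 := ![0, 0, 1, 1, 0, 0, 0, 0] (x.right 0)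
  let r : Fin 8 → ZMod 4 := fun i => ((gen 0 ^ a.val * gen 1 ^ b.val)⁻¹ * x).left i |>.toAdd
  let half : ZMod 4 → Fin 2 := ![0, 0, 1, 1]
  let d := half (r 1 - r 4)
  let k : ZMod 4 := r 4 + ![0, 1] d
  (a, b, half (r 0 - r 1), d, half (r 2 - r 1), k)

lemma exponents_word : Function.LeftInverse exponents word := by
  unfold Function.LeftInverse
  decide +kernel

lemma word_injective : Function.Injective word := exponents_word.injective

lemma commute_gen_five (x : Monomial8) : Commute x (gen 5) :=
  SemidirectProduct.ext (funext fun i => mul_comm (x.left i) _)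
    ((mul_one x.right).trans (one_mul x.right).symm)

lemma gen_five_pow_four : gen 5 ^ 4 = 1 := by
  decide +kernel

lemma word_mul_gen_five_pow (a b c d e : Fin 2) (k l : Fin 4) :
    word (a, b, c, d, e, k) * gen 5 ^ l.val = word (a, b, c, d, e, k + l) := by
  simp only [word]
  rw [mul_assoc, ← pow_add, Fin.val_add, ← pow_eq_pow_mod _ gen_five_pow_four]

lemma word_eq_mul_gen_five_pow (a b c d e : Fin 2) (k : Fin 4) :
    word (a, b, c, d, e, k) = word (a, b, c, d, e, 0) * gen 5 ^ k.val := by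
  rw [word_mul_gen_five_pow, zero_add]

lemma word_mul_gen_zero (a b c d e : Fin 2) : ∃ k,
    word (a, b, c, d, e, 0) * gen 0 = word (a + 1, b, c, d + a + b, e + a, k) := by
  revert a b c d e
  decide +kernel

lemma word_mul_gen_one (a b c d e : Fin 2) : ∃ k,
    word (a, b, c, d, e, 0) * gen 1 = word (a, b + 1, c + b, d + b, e + b, k) := by
  revert a b c d e
  decide +kernel

lemma word_mul_gen_two (a b c d e : Fin 2) : ∃ k,
    word (a, b, c, d, e, 0) * gen 2 = word (a, b, c + 1, d, e, k) := by
  revert a b c d e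
  decide +kernel

lemma word_mul_gen_three (a b c d e : Fin 2) : ∃ k,
    word (a, b, c, d, e, 0) * gen 3 = word (a, b, c, d + 1, e, k) := by
  revert a b c d e
  decide +kernel

lemma word_mul_gen_four (a b c d e : Fin 2) : ∃ k,
    word (a, b, c, d, e, 0) * gen 4 = word (a, b, c, d, e + 1, k) := by
  revert a b c d e
  decide +kernel

lemma word_mul_gen_mem_range (p : Exponents) (j : Fin 6) :
    word p * gen j ∈ Set.range word := by
  obtain ⟨a, b, c, d, e, k⟩ := p
  have h : ∃ a' b' c' d' e' k',
      word (a, b, c, d, e, 0) * gen j = word (a', b', c', d', e', k') := by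
    fin_cases j
    · exact ⟨_, _, _, _, _, word_mul_gen_zero a b c d e⟩
    · exact ⟨_, _, _, _, _, word_mul_gen_one a b c d e⟩
    · exact ⟨_, _, _, _, _, word_mul_gen_two a b c d e⟩
    · exact ⟨_, _, _, _, _, word_mul_gen_three a b c d e⟩
    · exact ⟨_, _, _, _, _, word_mul_gen_four a b c d e⟩
    · exact ⟨a, b, c, d, e, 1, (word_eq_mul_gen_five_pow a b c d e 1).symm⟩
  obtain ⟨a', b', c', d', e', k', h⟩ := h
  exact ⟨(a', b', c', d', e', k' + k), by
    rw [← word_mul_gen_five_pow, ← h, word_eq_mul_gen_five_pow a b c d e k, mul_assoc, mul_assoc,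
      ((commute_gen_five (gen j)).pow_right _).eq]⟩

lemma coe_closure_range_gen :
    (Subgroup.closure (Set.range gen) : Set Monomial8) = Set.range word := by
  have hgen (j) : gen j ∈ Subgroup.closure (Set.range gen) :=
    Subgroup.subset_closure (Set.mem_range_self j)
  have : Finite Monomial8 := Finite.of_equiv _ SemidirectProduct.equivProd.symm
  ext x
  constructor
  · intro hx
    rw [SetLike.mem_coe, ← Subgroup.mem_toSubmonoid, Subgroup.closure_toSubmonoid_of_finite] at hx
    induction hx using Submonoid.closure_induction_right with
    | one => exact ⟨0, by decide +kernel⟩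
    | mul_right x _ y hy ih =>
      obtain ⟨p, rfl⟩ := ih
      obtain ⟨j, rfl⟩ := hy
      exact word_mul_gen_mem_range p j
  · rintro ⟨p, rfl⟩
    simp only [word]
    repeat' apply mul_mem
    all_goals exact pow_mem (hgen _) _

lemma word_mul_self_of_zero (a b c d e : Fin 2) (hab : (a, b) ≠ 0) : ∃ k,
    word (a, b, c, d, e, 0) * word (a, b, c, d, e, 0) = word (0, 0, b, 1, a + b, k) := by
  revert a b c d e
  decide +kernel

/-- The square of a nondiagonal element of the group is a nonscalar diagonal transformation. -/
lemma word_mul_self (a b c d e : Fin 2) (k : Fin 4) (hab : (a, b) ≠ 0) : ∃ l,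
    word (a, b, c, d, e, k) * word (a, b, c, d, e, k) = word (0, 0, b, 1, a + b, l) := by
  obtain ⟨l, hl⟩ := word_mul_self_of_zero a b c d e hab
  refine ⟨l + k + k, ?_⟩
  rw [← word_mul_gen_five_pow, ← word_mul_gen_five_pow, ← hl, word_eq_mul_gen_five_pow,
    ((commute_gen_five _).pow_right _).symm.mul_mul_mul_comm, ← mul_assoc]

lemma word_diagonal_right (c d e : Fin 2) (k : Fin 4) : (word (0, 0, c, d, e, k)).right = 1 := by
  revert c d e k
  decide +kernel

/-- The sign pattern, up to scalars, of a diagonal element of the group. -/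
def signs (c d e : Fin 2) : Fin 8 → Fin 2 :=
  c • ![1, 0, 0, 1, 0, 1, 0, 1] + d • ![0, 0, 0, 0, 1, 1, 1, 1] + e • ![0, 0, 1, 1, 0, 0, 1, 1]

lemma left_word_diagonal_eq_iff (c d e : Fin 2) (k : Fin 4) (i j : Fin 8) :
    (word (0, 0, c, d, e, k)).left i = (word (0, 0, c, d, e, k)).left j ↔
      signs c d e i = signs c d e j := by
  revert c d e k i j
  decide +kernel

end Monomial8

set_option maxHeartbeats 1000000 in
/-- A point of the cone all of whose nonzero coordinates lie in a single eigenspace of a nonscalar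
diagonal element of the group vanishes. -/
lemma ConeSet.apply_eq_zero {v : Fin 8 → ℂ} (hv : v ∈ ConeSet) {c d e : Fin 2}
    (hne : (c, d, e) ≠ 0) (i : Fin 8)
    (h : ∀ j, Monomial8.signs c d e j ≠ Monomial8.signs c d e i → v j = 0) : v i = 0 := by
  obtain ⟨h0, h1, h2, h3⟩ := hv
  generalize ht : Monomial8.signs c d e i = t at h
  simp only [Fin.forall_fin_succ, IsEmpty.forall_iff, and_true] at h
  fin_cases c <;> fin_cases d <;> fin_cases e <;> first | exact absurd rfl hne | skip
  all_goals
    fin_cases t <;> simp [Monomial8.signs] at h <;>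
    · fin_cases i <;> first | exact absurd ht (by decide) | grind

open Monomial8

lemma ConeSet.eq_zero_of_diagonal {v : Fin 8 → ℂ} (hv : v ∈ ConeSet) {c d e : Fin 2}
    (hne : (c, d, e) ≠ 0) (k : Fin 4) {μ : ℂ}
    (h : toMatrix (word (0, 0, c, d, e, k)) *ᵥ v = μ • v) : v = 0 := by
  have eigen (i) : powI ((word (0, 0, c, d, e, k)).left i) * v i = μ * v i := by
    have := congrFun h i
    rwa [toMatrix_mulVec, word_diagonal_right] at this
  funext i
  by_contra hi
  refine hi (ConeSet.apply_eq_zero hv hne i fun j hj => ?_)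
  by_contra hj0
  refine hj ((left_word_diagonal_eq_iff c d e k j i).1 (powI_injective ?_))
  rw [mul_right_cancel₀ hj0 (eigen j), mul_right_cancel₀ hi (eigen i)]

lemma closure_setOf_coe_eq_map {ι : Type*} (f : ι → Monomial8)
    (P : Matrix (Fin 8) (Fin 8) ℂ → Prop) (hP : ∀ M, P M ↔ ∃ j, toMatrix (f j) = M) :
    Subgroup.closure {g : GL (Fin 8) ℂ | P g} =
      (Subgroup.closure (Set.range f)).map toGL := by
  rw [MonoidHom.map_closure, ← Set.range_comp]
  congr 1
  ext g
  simp only [Set.mem_ofPred_eq, hP, Set.mem_range, Function.comp_apply, Units.ext_iff, coe_toGL]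

lemma G32_eq_map : G32 = (Subgroup.closure (Set.range gen)).map toGL := by
  refine closure_setOf_coe_eq_map gen (fun M => M = h1M ∨ M = h2M ∨ M = h3M ∨ M = h4M ∨
    M = h5M ∨ M = h6M) fun M => ?_
  simp [Fin.exists_fin_succ, toMatrix_gen_zero, toMatrix_gen_one, toMatrix_gen_two,
    toMatrix_gen_three, toMatrix_gen_four, toMatrix_gen_five, eq_comm]

lemma ZZ_eq_zpowers_s14 : ZZ = Subgroup.zpowers (toGL (gen 5)) := by
  have h : toMatrix (gen 5) = iI := by
    rw [toMatrix_gen_five, iI, Matrix.smul_one_eq_diagonal]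
    refine congrArg Matrix.diagonal (funext fun i => ?_)
    fin_cases i <;> rfl
  rw [Subgroup.zpowers_eq_closure]
  refine congrArg Subgroup.closure (Set.ext fun g => ?_)
  simp [Units.ext_iff, h]

lemma mem_G32_iff {g : GL (Fin 8) ℂ} : g ∈ G32 ↔ ∃ p, toGL (word p) = g := by
  rw [G32_eq_map, ← SetLike.mem_coe, Subgroup.coe_map, coe_closure_range_gen, ← Set.range_comp]
  rfl

lemma card_G32 : Nat.card G32 = 128 := by
  rw [G32_eq_map, Subgroup.card_map_of_injective toGL_injective]
  change Nat.card (Subgroup.closure (Set.range gen) : Set Monomial8) = 128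
  rw [coe_closure_range_gen, Nat.card_range_of_injective word_injective]
  simp

lemma card_ZZ_s14 : Nat.card ZZ = 4 := by
  rw [ZZ_eq_zpowers_s14, Nat.card_zpowers, orderOf_injective toGL toGL_injective]
  exact orderOf_eq_prime_pow (p := 2) (n := 1) (by decide +kernel) (by decide +kernel)

lemma ZZ_le_G32 : ZZ ≤ G32 := by
  rw [ZZ_eq_zpowers_s14, G32_eq_map, Subgroup.zpowers_le]
  exact Subgroup.mem_map_of_mem _ (Subgroup.subset_closure (Set.mem_range_self 5))

lemma card_G32_quotient_ZZ : Nat.card (G32 ⧸ ZZ.subgroupOf G32) = 32 := by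
  have h := Subgroup.card_eq_card_quotient_mul_card_subgroup (ZZ.subgroupOf G32)
  rw [Nat.card_congr (Subgroup.subgroupOfEquivOfLe ZZ_le_G32).toEquiv, card_ZZ_s14, card_G32] at h
  omega

lemma mem_ZZ_of_mulVec_eq_smul {g : GL (Fin 8) ℂ} (hg : g ∈ G32) {v : Fin 8 → ℂ}
    (hv : v ∈ ConeSet) (hv0 : v ≠ 0) {μ : ℂ}
    (h : (g : Matrix (Fin 8) (Fin 8) ℂ) *ᵥ v = μ • v) : g ∈ ZZ := by
  obtain ⟨p, rfl⟩ := mem_G32_iff.1 hg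
  rw [coe_toGL] at h
  obtain ⟨a, b, c, d, e, k⟩ := p
  by_cases hab : (a, b) = 0
  · obtain ⟨rfl, rfl⟩ := Prod.mk.inj hab
    by_cases hcde : (c, d, e) = 0
    · obtain ⟨rfl, hde⟩ := Prod.mk.inj hcde
      obtain ⟨rfl, rfl⟩ := Prod.mk.inj hde
      rw [ZZ_eq_zpowers_s14]
      simp only [word, Fin.val_zero, pow_zero, one_mul, map_pow]
      exact Subgroup.npow_mem_zpowers _ _
    · exact absurd (ConeSet.eq_zero_of_diagonal hv hcde k h) hv0
  · obtain ⟨l, hl⟩ := word_mul_self a b c d e k hab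
    have hne : (b, 1, a + b) ≠ (0 : Fin 2 × Fin 2 × Fin 2) := by simp [Prod.ext_iff]
    refine absurd (ConeSet.eq_zero_of_diagonal hv hne l (μ := μ * μ) ?_) hv0
    rw [← hl, map_mul, ← Matrix.mulVec_mulVec, h, Matrix.mulVec_smul, h, smul_smul]

/-- `G` contains `𝒵`, has order `128` (so its image modulo `𝒵` has order `32`), and acts
freely on `𝒳`: if `g ∈ G` maps a nonzero point of the cone to a scalar multiple of
itself, then `g ∈ 𝒵`. -/
theorem statement14 :
    ZZ ≤ G32 ∧
    Nat.card G32 = 128 ∧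
    Nat.card (G32 ⧸ ZZ.subgroupOf G32) = 32 ∧
    (∀ g ∈ G32, ∀ v ∈ ConeSet, v ≠ 0 →
      (∃ c : ℂ, Matrix.mulVec (↑g : Matrix (Fin 8) (Fin 8) ℂ) v = c • v) → g ∈ ZZ) := by
  exact ⟨ZZ_le_G32, card_G32, card_G32_quotient_ZZ,
    fun _ hg _ hv hv0 ⟨_, h⟩ => mem_ZZ_of_mulVec_eq_smul hg hv hv0 h⟩
end
end
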